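/- arXiv:2305.02793 — 7 statements merged into one kernel-verified Lean document; each statement's English description precedes it below -/
import Mathlib

section
/- The number of vertices of the Zielonka tree Z_φ of an Emerson-Lei formula φ over a finite set C of colors is at most e·|C|!, where e is Euler's number. -/
/-- Emerson-Lei formulas over a set `C` of colors: Boolean formulas over atoms `Inf c`. -/
inductive ELFormula (C : Type) : Type
  | tt : ELFormula C
  | ff : ELFormula C
  | inf : C → ELFormula C
  | not : ELFormula C → ELFormula C
  | and : ELFormula C → ELFormula C → ELFormula C
  | or : ELFormula C → ELFormula C → ELFormula C

/-- Satisfaction of an Emerson-Lei formula by a set `D` of colors. -/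
def ELSat {C : Type} (D : Set C) : ELFormula C → Prop
  | .tt => True
  | .ff => False
  | .inf c => c ∈ D
  | .not f => ¬ ELSat D f
  | .and f g => ELSat D f ∧ ELSat D g
  | .or f g => ELSat D f ∨ ELSat D g

/-- `D` is a candidate child-label for a vertex labeled `L`:
`D ⊊ L` and `D ⊨ φ ⟺ L ⊭ φ`. -/
def ELCand {C : Type} [DecidableEq C] (φ : ELFormula C) (L D : Finset C) : Prop :=
  D ⊂ L ∧ (ELSat (↑D) φ ↔ ¬ ELSat (↑L) φ)

/-- `D` is maximal among the candidate child-labels for a vertex labeled `L`. -/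
def ELMaxCand {C : Type} [DecidableEq C] (φ : ELFormula C) (L D : Finset C) : Prop :=
  ELCand φ L D ∧ ∀ D' : Finset C, ELCand φ L D' → D ⊆ D' → D = D'

/-- The Zielonka tree of an Emerson-Lei formula `φ` over a finite set `C` of colors:
a finite tree rooted at `root`, whose root is labeled `C`, and in which every vertex `s`
has exactly one child labeled `D` for each `D` maximal among
`{D' ⊊ l(s) | D' ⊨ φ ⟺ l(s) ⊭ φ}`. -/
structure ZielonkaTree (C : Type) [Fintype C] [DecidableEq C] (φ : ELFormula C) where
  V : Type
  [finV : Fintype V]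
  [decV : DecidableEq V]
  root : V
  children : V → Finset V
  label : V → Finset C
  root_label : label root = Finset.univ
  reach_root : ∀ t, Relation.ReflTransGen (fun a b => b ∈ children a) root t
  parent_unique : ∀ ⦃s s' t⦄, t ∈ children s → t ∈ children s' → s = s'
  root_not_child : ∀ s, root ∉ children s
  child_maximal : ∀ ⦃s t⦄, t ∈ children s → ELMaxCand φ (label s) (label t)
  child_exists : ∀ ⦃s⦄ ⦃D : Finset C⦄, ELMaxCand φ (label s) D → ∃ t ∈ children s, label t = D
  child_label_inj : ∀ ⦃s t t'⦄, t ∈ children s → t' ∈ children s → label t = label t' → t = t'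

attribute [instance] ZielonkaTree.finV ZielonkaTree.decV

/-- The number of arrangements (injective lists) of an `n`-element set. -/
def arrangementNumber : ℕ → ℕ
  | 0 => 1
  | n + 1 => (n + 1) * arrangementNumber n + 1

theorem arrangementNumber_eq_factorial_mul_sum (n : ℕ) :
    (arrangementNumber n : ℝ) =
      n.factorial * ∑ k ∈ Finset.range (n + 1), (1 : ℝ) ^ k / k.factorial := by
  induction n with
  | zero => simp [arrangementNumber]
  | succ n ih =>
    have hn : ((n + 1).factorial : ℝ) ≠ 0 := by positivity
    rw [Finset.sum_range_succ, mul_add, one_pow, mul_one_div_cancel hn, Nat.factorial_succ,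
      arrangementNumber]
    push_cast
    rw [ih, mul_assoc]

theorem arrangementNumber_le_exp_one_mul_factorial (n : ℕ) :
    (arrangementNumber n : ℝ) ≤ Real.exp 1 * n.factorial := by
  rw [arrangementNumber_eq_factorial_mul_sum, mul_comm]
  gcongr
  exact Real.sum_le_exp_of_nonneg zero_le_one _

theorem arrangementNumber_mul_choose_le {n d : ℕ} (h : d ≤ n) :
    arrangementNumber d * (n + 1).choose d ≤ arrangementNumber n * (n + 1) := by
  induction h using Nat.decreasingInduction with
  | self => simp
  | of_succ d hd ih =>
    refine le_trans ?_ ih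
    have hsub : 1 ≤ n + 1 - d := by omega
    calc
      arrangementNumber d * (n + 1).choose d
        ≤ arrangementNumber d * ((n + 1).choose d * (n + 1 - d)) := by
          gcongr
          exact Nat.le_mul_of_pos_right _ hsub
      _ = (d + 1) * arrangementNumber d * (n + 1).choose (d + 1) := by
          rw [← Nat.choose_succ_right_eq]
          ring
      _ ≤ arrangementNumber (d + 1) * (n + 1).choose (d + 1) := by
          gcongr
          exact Nat.le_succ _

theorem IsAntichain.sum_arrangementNumber_card_lt {α : Type*} [Fintype α]
    {𝒜 : Finset (Finset α)} (h𝒜 : IsAntichain (· ⊆ ·) (𝒜 : Set (Finset α)))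
    (huniv : Finset.univ ∉ 𝒜) :
    ∑ s ∈ 𝒜, arrangementNumber s.card < arrangementNumber (Fintype.card α) := by
  have hcard : ∀ s ∈ 𝒜, s.card < Fintype.card α := fun s hs =>
    (Finset.card_lt_iff_ne_univ s).2 fun h => huniv (h ▸ hs)
  rcases hα : Fintype.card α with _ | n
  · rw [Finset.sum_eq_zero fun s hs => absurd (hcard s hs) (by omega)]
    exact one_pos
  · rw [arrangementNumber, Nat.lt_succ_iff, mul_comm]
    have hlym := Finset.lubell_yamamoto_meshalkin_inequality_sum_inv_choose (𝕜 := ℚ) h𝒜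
    rw [hα] at hlym
    have hbound : ∀ s ∈ 𝒜, (arrangementNumber s.card : ℚ) ≤
        (arrangementNumber n * (n + 1) : ℕ) * ((n + 1).choose s.card : ℚ)⁻¹ := by
      intro s hs
      have hs' := hcard s hs
      have hpos : (0 : ℚ) < (n + 1).choose s.card :=
        mod_cast Nat.choose_pos (by omega)
      rw [← div_eq_mul_inv, le_div_iff₀ hpos]
      exact_mod_cast arrangementNumber_mul_choose_le (by omega)
    have hsum := Finset.sum_le_sum hbound
    rw [← Finset.mul_sum] at hsum
    have := hsum.trans (mul_le_of_le_one_right (Nat.cast_nonneg _) hlym)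
    exact_mod_cast this

theorem IsAntichain.sum_arrangementNumber_card_lt_of_ssubset {α : Type*} [DecidableEq α]
    {L : Finset α} {𝒜 : Finset (Finset α)} (h𝒜 : IsAntichain (· ⊆ ·) (𝒜 : Set (Finset α)))
    (hL : ∀ D ∈ 𝒜, D ⊂ L) :
    ∑ D ∈ 𝒜, arrangementNumber D.card < arrangementNumber L.card := by
  have hmap : ∀ D ∈ 𝒜, (D.subtype (· ∈ L)).map (Function.Embedding.subtype _) = D :=
    fun D hD => Finset.subtype_map_of_mem fun _ hx => (hL D hD).1 hx
  have hinj : Set.InjOn (Finset.subtype (· ∈ L)) (𝒜 : Set (Finset α)) := by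
    intro D hD E hE h
    rw [← hmap D hD, h, hmap E hE]
  have hanti : IsAntichain (· ⊆ ·)
      ((𝒜.image (Finset.subtype (· ∈ L)) : Finset (Finset L)) : Set (Finset L)) := by
    simp only [Finset.coe_image]
    rintro _ ⟨D, hD, rfl⟩ _ ⟨E, hE, rfl⟩ hne hsub
    refine h𝒜 hD hE (fun h => hne (by rw [h])) ?_
    rw [← hmap D hD, ← hmap E hE]
    exact Finset.map_subset_map.2 hsub
  have huniv : Finset.univ ∉ 𝒜.image (Finset.subtype (· ∈ L)) := by
    simp only [Finset.mem_image, not_exists, not_and]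
    intro D hD h
    refine (hL D hD).2 fun x hx => ?_
    have : (⟨x, hx⟩ : L) ∈ D.subtype (· ∈ L) := h ▸ Finset.mem_univ _
    exact Finset.mem_subtype.1 this
  have hlt := hanti.sum_arrangementNumber_card_lt huniv
  rw [Finset.sum_image hinj, Fintype.card_coe] at hlt
  refine lt_of_eq_of_lt (Finset.sum_congr rfl fun D hD => ?_) hlt
  conv_lhs => rw [← hmap D hD, Finset.card_map]

namespace ZielonkaTree

variable {C : Type} [Fintype C] [DecidableEq C] {φ : ELFormula C} (Z : ZielonkaTree C φ)

open Classical in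
/-- The vertices of the subtree rooted at `s`. -/
noncomputable def descendants (s : Z.V) : Finset Z.V :=
  {t | Relation.ReflTransGen (fun a b => b ∈ Z.children a) s t}

theorem descendants_subset (s : Z.V) :
    Z.descendants s ⊆ insert s ((Z.children s).biUnion Z.descendants) := by
  intro t ht
  simp only [descendants, Finset.mem_filter, Finset.mem_univ, true_and, Finset.mem_insert,
    Finset.mem_biUnion] at ht ⊢
  exact ht.cases_head.imp Eq.symm id

theorem isAntichain_image_label_children (s : Z.V) :
    IsAntichain (· ⊆ ·) (((Z.children s).image Z.label : Finset (Finset C)) : Set (Finset C)) := by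
  simp only [Finset.coe_image]
  rintro _ ⟨t, ht, rfl⟩ _ ⟨t', ht', rfl⟩ hne hsub
  exact hne ((Z.child_maximal ht).2 _ (Z.child_maximal ht').1 hsub)

theorem sum_arrangementNumber_children_lt (s : Z.V) :
    ∑ t ∈ Z.children s, arrangementNumber (Z.label t).card <
      arrangementNumber (Z.label s).card := by
  have hlt := (Z.isAntichain_image_label_children s).sum_arrangementNumber_card_lt_of_ssubset
    (L := Z.label s) (by
      simp only [Finset.mem_image]
      rintro _ ⟨t, ht, rfl⟩
      exact (Z.child_maximal ht).1.1)
  rwa [Finset.sum_image fun _ ht _ ht' h => Z.child_label_inj ht ht' h] at hlt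

theorem card_descendants_le (s : Z.V) :
    (Z.descendants s).card ≤ arrangementNumber (Z.label s).card := by
  induction hn : (Z.label s).card using Nat.strong_induction_on generalizing s with
  | _ n ih =>
    subst hn
    calc
      (Z.descendants s).card
        ≤ (insert s ((Z.children s).biUnion Z.descendants)).card :=
          Finset.card_le_card (Z.descendants_subset s)
      _ ≤ ((Z.children s).biUnion Z.descendants).card + 1 := Finset.card_insert_le _ _
      _ ≤ ∑ t ∈ Z.children s, (Z.descendants t).card + 1 := by
          gcongr
          exact Finset.card_biUnion_le
      _ ≤ ∑ t ∈ Z.children s, arrangementNumber (Z.label t).card + 1 := by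
          gcongr with t ht
          exact ih _ (Finset.card_lt_card (Z.child_maximal ht).1.1) t rfl
      _ ≤ arrangementNumber (Z.label s).card := Z.sum_arrangementNumber_children_lt s

theorem descendants_root : Z.descendants Z.root = Finset.univ := by
  simp [descendants, Z.reach_root]

end ZielonkaTree

/-- The number of vertices of the Zielonka tree of an Emerson-Lei formula `φ` over a finite
set `C` of colors is at most `e * |C|!`, where `e` is Euler's number. -/
theorem zielonka_card_le_e_mul_factorial
    {C : Type} [Fintype C] [DecidableEq C] (φ : ELFormula C) (Z : ZielonkaTree C φ) :
    (@Fintype.card Z.V Z.finV : ℝ) ≤ Real.exp 1 * (Nat.factorial (Fintype.card C)) := by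
  have hcard := Z.card_descendants_le Z.root
  rw [Z.descendants_root, Z.root_label, Finset.card_univ, Finset.card_univ] at hcard
  exact (Nat.cast_le.2 hcard).trans (arrangementNumber_le_exp_one_mul_factorial _)
end

section
/- Let C be a finite set of colors with |C| = n and let φ_even be the Emerson-Lei formula ⋁_{D ⊆ C, |D| even} (⋀_{c ∈ D} Inf c ∧ ⋀_{d ∈ C∖D} Fin d), expressing that the number of colors visited infinitely often is even. Then the Zielonka tree Z_{φ_even} coincides with the maximal labeled tree T^m_C: every vertex with label D has exactly |D| children, labeled D∖{c} for each c ∈ D; in particular Z_{φ_even} has exactly n!·∑_{k=0}^{n} 1/k! vertices. -/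
/-- Finite conjunction of a list of Emerson-Lei formulas. -/
def bigAnd {C : Type} : List (ELFormula C) → ELFormula C
  | [] => .tt
  | f :: fs => .and f (bigAnd fs)

/-- Finite disjunction of a list of Emerson-Lei formulas. -/
def bigOr {C : Type} : List (ELFormula C) → ELFormula C
  | [] => .ff
  | f :: fs => .or f (bigOr fs)

/-- The Emerson-Lei formula `⋁_{D ⊆ C, |D| even} (⋀_{c ∈ D} Inf c ∧ ⋀_{d ∈ C∖D} Fin d)`,
expressing that the number of colors visited infinitely often is even. -/
noncomputable def evenFormula (C : Type) [Fintype C] [DecidableEq C] : ELFormula C :=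
  bigOr
    ((((Finset.univ : Finset (Finset C)).filter fun D => Even D.card).toList).map fun D =>
      .and (bigAnd (D.toList.map .inf))
        (bigAnd ((Dᶜ : Finset C).toList.map fun d => .not (.inf d))))

theorem elSat_bigAnd {C : Type} (D : Set C) (l : List (ELFormula C)) :
    ELSat D (bigAnd l) ↔ ∀ f ∈ l, ELSat D f := by
  induction l with
  | nil => simp [bigAnd, ELSat]
  | cons f l ih => simp [bigAnd, ELSat, ih]

theorem elSat_bigOr {C : Type} (D : Set C) (l : List (ELFormula C)) :
    ELSat D (bigOr l) ↔ ∃ f ∈ l, ELSat D f := by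
  induction l with
  | nil => simp [bigOr, ELSat]
  | cons f l ih => simp [bigOr, ELSat, ih]

theorem elSat_evenFormula {C : Type} [Fintype C] [DecidableEq C] (D : Finset C) :
    ELSat (↑D) (evenFormula C) ↔ Even D.card := by
  have key (E : Finset C) : ((∀ c ∈ E, c ∈ D) ∧ ∀ c, c ∉ E → c ∉ D) ↔ E = D := by
    rw [Finset.ext_iff]
    grind
  simp [evenFormula, elSat_bigOr, elSat_bigAnd, ELSat, key]

theorem elCand_erase {C : Type} [Fintype C] [DecidableEq C] {L : Finset C} {c : C}
    (hc : c ∈ L) : ELCand (evenFormula C) L (L.erase c) := by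
  refine ⟨Finset.erase_ssubset hc, ?_⟩
  rw [elSat_evenFormula, elSat_evenFormula, ← Finset.card_erase_add_one hc, Nat.even_add_one,
    not_not]

theorem elMaxCand_evenFormula_iff {C : Type} [Fintype C] [DecidableEq C] {L D : Finset C} :
    ELMaxCand (evenFormula C) L D ↔ ∃ c ∈ L, D = L.erase c := by
  constructor
  · rintro ⟨⟨hDL, -⟩, hmax⟩
    obtain ⟨c, hcL, hcD⟩ := Finset.exists_of_ssubset hDL
    exact ⟨c, hcL, hmax _ (elCand_erase hcL) (Finset.subset_erase.2 ⟨hDL.1, hcD⟩)⟩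
  · rintro ⟨c, hc, rfl⟩
    refine ⟨elCand_erase hc, fun D' hD' hsub => Finset.eq_of_subset_of_card_le hsub ?_⟩
    have h₁ := Finset.card_lt_card hD'.1
    have h₂ := Finset.card_erase_add_one hc
    omega

namespace ZielonkaTree

variable {C : Type} [Fintype C] [DecidableEq C]

theorem eq_root_or_mem_children {φ : ELFormula C} (Z : ZielonkaTree C φ) (t : Z.V) :
    t = Z.root ∨ ∃ s, t ∈ Z.children s := by
  rcases Relation.ReflTransGen.cases_tail (Z.reach_root t) with h | ⟨s, -, hs⟩
  · exact Or.inl h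
  · exact Or.inr ⟨s, hs⟩

theorem label_eq_univ_iff {φ : ELFormula C} (Z : ZielonkaTree C φ) (t : Z.V) :
    Z.label t = Finset.univ ↔ t = Z.root := by
  refine ⟨fun h => ?_, fun h => h ▸ Z.root_label⟩
  rcases Z.eq_root_or_mem_children t with ht | ⟨s, hs⟩
  · exact ht
  · have hlt := (Z.child_maximal hs).1.1
    rw [h] at hlt
    exact absurd (Finset.subset_univ _) hlt.2

variable (Z : ZielonkaTree C (evenFormula C))

theorem image_label_children (s : Z.V) :
    (Z.children s).image Z.label = (Z.label s).image (Z.label s).erase := by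
  ext D
  simp only [Finset.mem_image]
  constructor
  · rintro ⟨t, ht, rfl⟩
    obtain ⟨c, hc, h⟩ := elMaxCand_evenFormula_iff.1 (Z.child_maximal ht)
    exact ⟨c, hc, h.symm⟩
  · rintro ⟨c, hc, rfl⟩
    exact Z.child_exists (elMaxCand_evenFormula_iff.2 ⟨c, hc, rfl⟩)

theorem card_children (s : Z.V) : (Z.children s).card = (Z.label s).card := by
  rw [← Finset.card_image_of_injOn (f := Z.label) fun _ ht _ ht' h => Z.child_label_inj ht ht' h,
    image_label_children, Finset.card_image_of_injOn (Finset.erase_injOn _)]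

theorem card_label_of_mem_children {s t : Z.V} (ht : t ∈ Z.children s) :
    (Z.label t).card + 1 = (Z.label s).card := by
  obtain ⟨c, hc, h⟩ := elMaxCand_evenFormula_iff.1 (Z.child_maximal ht)
  rw [h, Finset.card_erase_add_one hc]

/-- The vertices whose label has exactly `j` colors. -/
def level (j : ℕ) : Finset Z.V := Finset.univ.filter fun t => (Z.label t).card = j

theorem level_card : Z.level (Fintype.card C) = {Z.root} := by
  ext t
  simp [level, Finset.card_eq_iff_eq_univ, label_eq_univ_iff]

theorem level_eq_biUnion {j : ℕ} (hj : j < Fintype.card C) :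
    Z.level j = (Z.level (j + 1)).biUnion Z.children := by
  ext t
  simp only [level, Finset.mem_filter, Finset.mem_univ, true_and, Finset.mem_biUnion]
  constructor
  · intro ht
    rcases Z.eq_root_or_mem_children t with rfl | ⟨s, hs⟩
    · rw [Z.root_label, Finset.card_univ] at ht
      omega
    · exact ⟨s, by rw [← Z.card_label_of_mem_children hs, ht], hs⟩
  · rintro ⟨s, hs, ht⟩
    have := Z.card_label_of_mem_children ht
    omega

theorem card_level_eq_mul {j : ℕ} (hj : j < Fintype.card C) :
    (Z.level j).card = (Z.level (j + 1)).card * (j + 1) := by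
  rw [Z.level_eq_biUnion hj, Finset.card_biUnion]
  · refine Finset.sum_const_nat fun s hs => ?_
    rw [card_children, (Finset.mem_filter.1 hs).2]
  · intro s _ s' _ hne
    exact Finset.disjoint_left.2 fun t ht ht' => hne (Z.parent_unique ht ht')

theorem card_level_mul_factorial {j : ℕ} (hj : j ≤ Fintype.card C) :
    (Z.level j).card * j.factorial = (Fintype.card C).factorial := by
  induction hj using Nat.decreasingInduction with
  | self => simp [level_card]
  | of_succ j hj ih => rw [← ih, Z.card_level_eq_mul hj, Nat.factorial_succ, mul_assoc]

theorem card_eq_sum_card_level :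
    Fintype.card Z.V = ∑ j ∈ Finset.range (Fintype.card C + 1), (Z.level j).card :=
  Finset.card_eq_sum_card_fiberwise fun t _ =>
    Finset.mem_coe.2 (Finset.mem_range.2 (Nat.lt_succ_of_le (Finset.card_le_univ (Z.label t))))

end ZielonkaTree

/-- For the Emerson-Lei formula `φ_even` stating that the number of colors visited
infinitely often is even, the Zielonka tree coincides with the maximal labeled tree
`T^m_C`: every vertex with label `D` has exactly `|D|` children, one labeled `D \ {c}`
for each `c ∈ D`; in particular the tree has exactly `n! * ∑_{k=0}^{n} 1/k!` vertices,
where `n = |C|`. -/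
theorem zielonka_evenFormula_is_maximal_tree
    {C : Type} [Fintype C] [DecidableEq C] (Z : ZielonkaTree C (evenFormula C)) :
    (∀ s : Z.V,
      (Z.children s).card = (Z.label s).card ∧
      (∀ c ∈ Z.label s, ∃! t : Z.V, t ∈ Z.children s ∧ Z.label t = (Z.label s).erase c) ∧
      (∀ t ∈ Z.children s, ∃ c ∈ Z.label s, Z.label t = (Z.label s).erase c)) ∧
    (@Fintype.card Z.V Z.finV : ℝ) =
      (Nat.factorial (Fintype.card C) : ℝ) *
        ∑ k ∈ Finset.range (Fintype.card C + 1), 1 / (Nat.factorial k : ℝ) := by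
  refine ⟨fun s => ⟨Z.card_children s, fun c hc => ?_, fun t ht =>
    elMaxCand_evenFormula_iff.1 (Z.child_maximal ht)⟩, ?_⟩
  · obtain ⟨t, ht, hl⟩ := Z.child_exists (elMaxCand_evenFormula_iff.2 ⟨c, hc, rfl⟩)
    exact ⟨t, ⟨ht, hl⟩, fun t' ht' => Z.child_label_inj ht'.1 ht (ht'.2.trans hl.symm)⟩
  · rw [Z.card_eq_sum_card_level, Nat.cast_sum, Finset.mul_sum]
    refine Finset.sum_congr rfl fun j hj => ?_
    rw [← Z.card_level_mul_factorial (Nat.le_of_lt_succ (Finset.mem_range.1 hj)), Nat.cast_mul,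
      mul_assoc, mul_one_div_cancel (Nat.cast_ne_zero.2 j.factorial_ne_zero), mul_one]
end

section
/- For every play π of an Emerson-Lei game and every walk ρ through the Zielonka tree Z_φ induced by π, every color that is visited infinitely often by π is contained in the label l(d_ρ) of the dominating vertex d_ρ of ρ. -/
/-- A game arena: a set of nodes (the type `N`) partitioned into existential nodes
(`Vex`) and universal nodes (the complement), with a move relation `E` such that every
node has at least one successor. -/
structure Arena (N : Type) where
  Vex : Set N
  E : N → Set N
  E_nonempty : ∀ v, (E v).Nonempty

/-- A play of an arena: an infinite sequence of nodes following moves. -/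
def Arena.IsPlay {N : Type} (A : Arena N) (π : ℕ → N) : Prop :=
  ∀ i, π (i + 1) ∈ A.E (π i)

/-- The existential player wins node `v` for objective `α`: there is a strategy
(mapping a history together with a current existential node to a successor) such that
every play starting at `v` and compliant with it satisfies `α`. -/
def WinsFrom {N : Type} (A : Arena N) (α : (ℕ → N) → Prop) (v : N) : Prop :=
  ∃ σ : List N → N → N,
    (∀ h u, u ∈ A.Vex → σ h u ∈ A.E u) ∧
    ∀ π : ℕ → N, A.IsPlay π → π 0 = v →
      (∀ i, π i ∈ A.Vex → π (i + 1) = σ ((List.range i).map π) (π i)) → α π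

/-- The Emerson-Lei objective `α_{γ,φ}`: the set of colors visited infinitely often
by the play satisfies `φ`. -/
def ELObjective {N C : Type} (γ : N → Finset C) (φ : ELFormula C) (π : ℕ → N) : Prop :=
  ELSat {c : C | ∀ M : ℕ, ∃ i ≥ M, c ∈ γ (π i)} φ

namespace ZielonkaTree

variable {C : Type} [Fintype C] [DecidableEq C] {φ : ELFormula C}

/-- The ancestor ordering of the Zielonka tree: `Z.anc s t` iff `s` is an ancestor of `t`
(or `s = t`). -/
def anc (Z : ZielonkaTree C φ) (s t : Z.V) : Prop :=
  Relation.ReflTransGen (fun a b => b ∈ Z.children a) s t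

/-- A leaf of the Zielonka tree. -/
def IsLeaf (Z : ZielonkaTree C φ) (t : Z.V) : Prop := Z.children t = ∅

/-- A winning vertex of the Zielonka tree (an element of `T_□`): its label satisfies `φ`. -/
def Winning (Z : ZielonkaTree C φ) (t : Z.V) : Prop := ELSat (↑(Z.label t)) φ

/-- `s` is the anchor node of `t` at a node colored `g`: the lowermost ancestor of `t`
whose label contains `g`. -/
def IsAnchor (Z : ZielonkaTree C φ) (g : Finset C) (t s : Z.V) : Prop :=
  Z.anc s t ∧ g ⊆ Z.label s ∧ ∀ s', Z.anc s' t → g ⊆ Z.label s' → Z.anc s' s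

end ZielonkaTree

namespace ZielonkaTree

variable {C : Type} [Fintype C] [DecidableEq C] {φ : ELFormula C}

/-- `c'` is the cyclically next child of `s` after `c`, with respect to the numbering
`num` of the vertices of the Zielonka tree: either `c'` is the num-least child strictly
above `c`, or `c` is the num-greatest child and `c'` the num-least one. -/
def CyclicNext (Z : ZielonkaTree C φ) (num : Z.V → ℕ) (s c c' : Z.V) : Prop :=
  c ∈ Z.children s ∧ c' ∈ Z.children s ∧
    ((num c < num c' ∧ ∀ d ∈ Z.children s, ¬ (num c < num d ∧ num d < num c')) ∨
     ((∀ d ∈ Z.children s, num d ≤ num c) ∧ (∀ d ∈ Z.children s, num c' ≤ num d)))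

/-- An induced walk `ρ = t₀ s₁ t₁ s₂ t₂ …` of a play `π` through the Zielonka tree
(`lf i` is the leaf `tᵢ` and `an i` is the vertex `s_{i+1}`): the walk starts at the
`num`-minimal leaf; `s_{i+1}` is the anchor node of `tᵢ` at `vᵢ`; `t_{i+1}` is a leaf
below `s_{i+1}`; and at winning vertices `s_{i+1}` the walk cycles fairly through the
children: if `tᵢ` lies below child `c` of `s_{i+1}`, then `t_{i+1}` lies below the
cyclically next child. -/
structure InducedWalk {N : Type} (Z : ZielonkaTree C φ) (num : Z.V → ℕ)
    (γ : N → Finset C) (π : ℕ → N) where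
  lf : ℕ → Z.V
  an : ℕ → Z.V
  lf_leaf : ∀ i, Z.IsLeaf (lf i)
  lf0_min : ∀ u : Z.V, Z.IsLeaf u → num (lf 0) ≤ num u
  an_anchor : ∀ i, Z.IsAnchor (γ (π i)) (lf i) (an i)
  lf_below : ∀ i, Z.anc (an i) (lf (i + 1))
  fair : ∀ i c c', Z.Winning (an i) →
    c ∈ Z.children (an i) → Z.anc c (lf i) →
    c' ∈ Z.children (an i) → Z.anc c' (lf (i + 1)) →
    Z.CyclicNext num (an i) c c'

/-- A vertex of the Zielonka tree is visited infinitely often by an induced walk. -/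
def InducedWalk.InfOften {N : Type} {Z : ZielonkaTree C φ} {num : Z.V → ℕ}
    {γ : N → Finset C} {π : ℕ → N} (w : Z.InducedWalk num γ π) (u : Z.V) : Prop :=
  ∀ M : ℕ, ∃ i ≥ M, w.lf i = u ∨ w.an i = u

/-- `d` is the dominating vertex of the induced walk `w`: the (unique) topmost vertex
visited infinitely often by `w`. -/
def InducedWalk.IsDominating {N : Type} {Z : ZielonkaTree C φ} {num : Z.V → ℕ}
    {γ : N → Finset C} {π : ℕ → N} (w : Z.InducedWalk num γ π) (d : Z.V) : Prop :=
  w.InfOften d ∧ ∀ u : Z.V, w.InfOften u → Z.anc d u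

end ZielonkaTree

/-- Labels shrink along the ancestor ordering of the Zielonka tree. -/
theorem ZielonkaTree.anc.label_subset {C : Type} [Fintype C] [DecidableEq C] {φ : ELFormula C}
    {Z : ZielonkaTree C φ} {s t : Z.V} (h : Z.anc s t) : Z.label t ⊆ Z.label s := by
  induction h with
  | refl => exact subset_rfl
  | tail _ hbc ih => exact (Z.child_maximal hbc).1.1.subset.trans ih

/-- If a color is visited infinitely often, then some vertex whose label contains that color
is an anchor node of the walk infinitely often. -/
theorem ZielonkaTree.InducedWalk.exists_infOften_mem_label {C N : Type} [Fintype C]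
    [DecidableEq C] {φ : ELFormula C} {Z : ZielonkaTree C φ} {num : Z.V → ℕ}
    {γ : N → Finset C} {π : ℕ → N} (w : Z.InducedWalk num γ π) {c : C}
    (hc : ∀ M : ℕ, ∃ i ≥ M, c ∈ γ (π i)) : ∃ u, w.InfOften u ∧ c ∈ Z.label u := by
  obtain ⟨u, hu⟩ : ∃ u, ∃ᶠ i in Filter.atTop, c ∈ γ (π i) ∧ w.an i = u := by
    by_contra! h
    obtain ⟨i, hci, hi⟩ :=
      ((Filter.frequently_atTop.2 hc).and_eventually (Filter.eventually_all.2 h)).exists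
    exact hi (w.an i) hci rfl
  refine ⟨u, fun M => ?_, ?_⟩
  · obtain ⟨i, hi, -, hiu⟩ := Filter.frequently_atTop.1 hu M
    exact ⟨i, hi, Or.inr hiu⟩
  · obtain ⟨i, hci, rfl⟩ := hu.exists
    exact (w.an_anchor i).2.1 hci

/-- For every play `π` of an Emerson-Lei game and every walk through the Zielonka tree
`Z_φ` induced by `π`, every color visited infinitely often by `π` is contained in the
label of the dominating vertex of the walk. -/
theorem color_infOften_mem_dominating_label
    {C N : Type} [Fintype C] [DecidableEq C] (φ : ELFormula C) (Z : ZielonkaTree C φ)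
    (A : Arena N) (γ : N → Finset C)
    (num : Z.V → ℕ) (hnum : Function.Injective num)
    (π : ℕ → N) (hπ : A.IsPlay π)
    (w : Z.InducedWalk num γ π) (d : Z.V) (hd : w.IsDominating d) :
    ∀ c : C, (∀ M : ℕ, ∃ i ≥ M, c ∈ γ (π i)) → c ∈ Z.label d := by
  intro c hc
  obtain ⟨u, hu, hcu⟩ := w.exists_infOften_mem_label hc
  exact (hd.2 u hu).label_subset hcu
end

section
/- A play π of an Emerson-Lei game with objective α_{γ,φ} is winning for the existential player (i.e., the set of colors visited infinitely often by π satisfies φ) if and only if π induces some walk ρ through the Zielonka tree Z_φ whose dominating vertex d_ρ is a winning vertex (d_ρ ∈ T_□). -/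
namespace ZielonkaTree

variable {C : Type} [Fintype C] [DecidableEq C] {φ : ELFormula C} {Z : ZielonkaTree C φ}

theorem card_label_lt {s c : Z.V} (h : c ∈ Z.children s) :
    (Z.label c).card < (Z.label s).card :=
  Finset.card_lt_card (Z.child_maximal h).1.1

theorem anc.trans {s t u : Z.V} (h : Z.anc s t) (h' : Z.anc t u) : Z.anc s u :=
  Relation.ReflTransGen.trans h h'

theorem anc_of_mem_children {s c : Z.V} (h : c ∈ Z.children s) : Z.anc s c :=
  Relation.ReflTransGen.single h

theorem anc.label_subset_s6 {s t : Z.V} (h : Z.anc s t) : Z.label t ⊆ Z.label s := by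
  induction h with
  | refl => exact subset_rfl
  | tail _ hc ih => exact (Z.child_maximal hc).1.1.subset.trans ih

theorem anc.exists_child {s t : Z.V} (h : Z.anc s t) (hne : s ≠ t) :
    ∃ c ∈ Z.children s, Z.anc c t := by
  rcases Relation.ReflTransGen.cases_head h with rfl | ⟨c, hc, hct⟩
  · exact absurd rfl hne
  · exact ⟨c, hc, hct⟩

theorem anc.exists_parent {s t : Z.V} (h : Z.anc s t) (hne : s ≠ t) :
    ∃ p, t ∈ Z.children p ∧ Z.anc s p := by
  rcases Relation.ReflTransGen.cases_tail h with rfl | ⟨p, hp, ht⟩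
  · exact absurd rfl hne
  · exact ⟨p, ht, hp⟩

theorem anc.eq_of_card_le {s t : Z.V} (h : Z.anc s t)
    (hcard : (Z.label s).card ≤ (Z.label t).card) : s = t := by
  by_contra hne
  obtain ⟨c, hc, hct⟩ := h.exists_child hne
  have h1 := card_label_lt hc
  have h2 := Finset.card_le_card hct.label_subset_s6
  omega

theorem anc.antisymm {s t : Z.V} (h : Z.anc s t) (h' : Z.anc t s) : s = t :=
  h.eq_of_card_le (Finset.card_le_card h'.label_subset_s6)

theorem anc.total {s t u : Z.V} (hs : Z.anc s u) (ht : Z.anc t u) : Z.anc s t ∨ Z.anc t s := by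
  induction hs with
  | refl => exact Or.inr ht
  | @tail b u hsb hu ih =>
    by_cases hne : t = u
    · subst hne
      exact Or.inl (Relation.ReflTransGen.tail hsb hu)
    · obtain ⟨p, hp, htp⟩ := ht.exists_parent hne
      rw [Z.parent_unique hp hu] at htp
      exact ih htp

theorem not_anc_of_mem_children {s c : Z.V} (h : c ∈ Z.children s) : ¬ Z.anc c s := fun h' =>
  absurd (Finset.card_le_card h'.label_subset_s6) (card_label_lt h).not_ge

theorem anc.eq_or_anc_parent {s c t : Z.V} (hc : c ∈ Z.children s) (h : Z.anc t c) :
    t = c ∨ Z.anc t s := by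
  by_cases hne : t = c
  · exact Or.inl hne
  · obtain ⟨p, hp, htp⟩ := h.exists_parent hne
    exact Or.inr (Z.parent_unique hp hc ▸ htp)

theorem child_unique {s c c' t : Z.V} (hc : c ∈ Z.children s) (hc' : c' ∈ Z.children s)
    (h : Z.anc c t) (h' : Z.anc c' t) : c = c' := by
  rcases h.total h' with h1 | h1
  · exact (h1.eq_or_anc_parent hc').resolve_right (not_anc_of_mem_children hc)
  · exact ((h1.eq_or_anc_parent hc).resolve_right (not_anc_of_mem_children hc')).symm

theorem exists_leaf_below (s : Z.V) : ∃ t, Z.IsLeaf t ∧ Z.anc s t := by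
  induction hn : (Z.label s).card using Nat.strong_induction_on generalizing s with
  | _ n ih =>
    by_cases hs : Z.IsLeaf s
    · exact ⟨s, hs, Relation.ReflTransGen.refl⟩
    · obtain ⟨c, hc⟩ := Finset.nonempty_iff_ne_empty.mpr hs
      obtain ⟨t, ht, hct⟩ := ih _ (hn ▸ card_label_lt hc) c rfl
      exact ⟨t, ht, (anc_of_mem_children hc).trans hct⟩

/-- A set of colors inside the label of `s` whose status differs from that of `s` is contained
in the label of some child of `s`. -/
theorem exists_child_label_superset {s : Z.V} {D : Finset C} (hD : D ⊆ Z.label s)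
    (hsat : ELSat (↑D) φ ↔ ¬ Z.Winning s) : ∃ c ∈ Z.children s, D ⊆ Z.label c := by
  have hcand : ELCand φ (Z.label s) D := by
    refine ⟨hD.ssubset_of_ne ?_, hsat⟩
    rintro rfl
    exact iff_not_self hsat
  obtain ⟨M, hDM, hM⟩ :=
    (Set.toFinite {D' : Finset C | ELCand φ (Z.label s) D'}).exists_le_maximal hcand
  obtain ⟨c, hc, rfl⟩ :=
    Z.child_exists ⟨hM.1, fun D' hD' hle => le_antisymm hle (hM.2 hD' hle)⟩
  exact ⟨c, hc, hDM⟩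

theorem exists_anchor (g : Finset C) (t : Z.V) : ∃ s, Z.IsAnchor g t s := by
  obtain ⟨s, ⟨hst, hgs⟩, hmin⟩ := Set.exists_min_image
    {s : Z.V | Z.anc s t ∧ g ⊆ Z.label s} (fun s => (Z.label s).card) (Set.toFinite _)
    ⟨Z.root, Z.reach_root t, by simp [Z.root_label]⟩
  refine ⟨s, hst, hgs, fun s' hs' hgs' => ?_⟩
  rcases hs'.total hst with h | h
  · exact h
  · rw [h.eq_of_card_le (hmin s' ⟨hs', hgs'⟩)]
    exact Relation.ReflTransGen.refl

theorem exists_cyclicNext (num : Z.V → ℕ) {s c : Z.V} (hc : c ∈ Z.children s) :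
    ∃ c', Z.CyclicNext num s c c' := by
  by_cases h : ((Z.children s).filter fun d => num c < num d).Nonempty
  · obtain ⟨c', hc', hmin⟩ := Finset.exists_min_image _ num h
    rw [Finset.mem_filter] at hc'
    refine ⟨c', hc, hc'.1, Or.inl ⟨hc'.2, fun d hd hlt => ?_⟩⟩
    exact (hmin d (Finset.mem_filter.mpr ⟨hd, hlt.1⟩)).not_gt hlt.2
  · obtain ⟨c', hc', hmin⟩ := Finset.exists_min_image _ num ⟨c, hc⟩
    refine ⟨c', hc, hc', Or.inr ⟨fun d hd => ?_, hmin⟩⟩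
    by_contra hlt
    exact h ⟨d, Finset.mem_filter.mpr ⟨hd, not_le.mp hlt⟩⟩

/-- A nonempty set of children in which every element has a cyclic successor contains
all children. -/
theorem mem_of_cyclicNext_closed {num : Z.V → ℕ} (hnum : Function.Injective num) {s : Z.V}
    {S : Set Z.V} (hS : S.Nonempty) (hnext : ∀ c ∈ S, ∃ c' ∈ S, Z.CyclicNext num s c c')
    {e : Z.V} (he : e ∈ Z.children s) : e ∈ S := by
  obtain ⟨m, hmS, hmax⟩ := Set.exists_max_image S num (Set.toFinite _) hS
  obtain ⟨l, hlS, -, -, hl⟩ := hnext m hmS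
  have hle : num l ≤ num e := by
    rcases hl with ⟨hlt, -⟩ | ⟨-, hl⟩
    · exact absurd (hmax l hlS) hlt.not_ge
    · exact hl e he
  obtain ⟨x, ⟨hxS, hxe⟩, hxmax⟩ := Set.exists_max_image
    {x | x ∈ S ∧ num x ≤ num e} num (Set.toFinite _) ⟨l, hlS, hle⟩
  rcases hxe.eq_or_lt with heq | hlt
  · exact hnum heq ▸ hxS
  obtain ⟨y, hyS, -, -, hy⟩ := hnext x hxS
  rcases hy with ⟨hxy, hno⟩ | ⟨hgr, -⟩
  · have hye : num y ≤ num e := not_lt.mp fun h => hno e he ⟨hlt, h⟩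
    exact absurd (hxmax y ⟨hyS, hye⟩) hxy.not_ge
  · exact absurd (hgr e he) hlt.not_ge

/-- One step of an induced walk, which at losing anchor nodes moves below a child whose label
contains `D` whenever there is one. -/
theorem exists_step (num : Z.V → ℕ) (D g : Finset C) {t : Z.V} (ht : Z.IsLeaf t) :
    ∃ s t', Z.IsLeaf t' ∧ Z.IsAnchor g t s ∧ Z.anc s t' ∧
      (∀ c c', Z.Winning s → c ∈ Z.children s → Z.anc c t →
        c' ∈ Z.children s → Z.anc c' t' → Z.CyclicNext num s c c') ∧
      (¬ Z.Winning s → (∃ c ∈ Z.children s, D ⊆ Z.label c) →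
        ∃ c ∈ Z.children s, D ⊆ Z.label c ∧ Z.anc c t') := by
  obtain ⟨s, hs⟩ := Z.exists_anchor g t
  by_cases hst : s = t
  · subst hst
    have hno : ∀ c, c ∉ Z.children s := fun c => by
      rw [show Z.children s = ∅ from ht]
      exact Finset.notMem_empty c
    exact ⟨s, s, ht, hs, hs.1, fun c _ _ hc => absurd hc (hno c),
      fun _ ⟨c, hc, _⟩ => absurd hc (hno c)⟩
  by_cases hw : Z.Winning s
  · obtain ⟨c, hc, hct⟩ := hs.1.exists_child hst
    obtain ⟨c', hcc'⟩ := exists_cyclicNext num hc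
    obtain ⟨t', ht', hct'⟩ := exists_leaf_below c'
    refine ⟨s, t', ht', hs, (anc_of_mem_children hcc'.2.1).trans hct', ?_,
      fun h => absurd hw h⟩
    intro b b' _ hb hbt hb' hbt'
    rw [child_unique hb hc hbt hct, child_unique hb' hcc'.2.1 hbt' hct']
    exact hcc'
  · by_cases hD : ∃ c ∈ Z.children s, D ⊆ Z.label c
    · obtain ⟨c, hc, hDc⟩ := hD
      obtain ⟨t', ht', hct'⟩ := exists_leaf_below c
      exact ⟨s, t', ht', hs, (anc_of_mem_children hc).trans hct',
        fun _ _ h => absurd h hw, fun _ _ => ⟨c, hc, hDc, hct'⟩⟩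
    · exact ⟨s, t, ht, hs, hs.1, fun _ _ h => absurd h hw, fun _ h => absurd h hD⟩

variable {N : Type} {num : Z.V → ℕ} {γ : N → Finset C} {π : ℕ → N}

theorem exists_inducedWalk (num : Z.V → ℕ) (γ : N → Finset C) (π : ℕ → N) (D : Finset C) :
    ∃ w : Z.InducedWalk num γ π, ∀ i, ¬ Z.Winning (w.an i) →
      (∃ c ∈ Z.children (w.an i), D ⊆ Z.label c) →
        ∃ c ∈ Z.children (w.an i), D ⊆ Z.label c ∧ Z.anc c (w.lf (i + 1)) := by
  obtain ⟨t₀, ht₀, hmin⟩ := Set.exists_min_image {t : Z.V | Z.IsLeaf t} num (Set.toFinite _)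
    ((exists_leaf_below Z.root).imp fun _ h => h.1)
  choose S T hleaf hanchor hbelow hfair hlose using
    fun (g : Finset C) (t : {t : Z.V // Z.IsLeaf t}) => exists_step num D g t.2
  let f : ℕ → {t : Z.V // Z.IsLeaf t} :=
    fun n => Nat.rec ⟨t₀, ht₀⟩ (fun i t => ⟨T (γ (π i)) t, hleaf _ t⟩) n
  exact ⟨{
    lf := fun i => (f i).1
    an := fun i => S (γ (π i)) (f i)
    lf_leaf := fun i => (f i).2
    lf0_min := hmin
    an_anchor := fun i => hanchor _ _
    lf_below := fun i => hbelow _ _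
    fair := fun i c c' => hfair _ _ c c' }, fun i => hlose _ _⟩

namespace InducedWalk

variable (w : Z.InducedWalk num γ π)

theorem eventually_infOften :
    ∃ M, ∀ i ≥ M, w.InfOften (w.lf i) ∧ w.InfOften (w.an i) := by
  have h : ∀ u, ∃ M, ∀ i ≥ M, (w.lf i = u ∨ w.an i = u) → w.InfOften u := by
    intro u
    by_cases hu : w.InfOften u
    · exact ⟨0, fun _ _ _ => hu⟩
    · simp only [InfOften, not_forall, not_exists, not_and] at hu
      obtain ⟨M, hM⟩ := hu
      exact ⟨M, fun i hi h => absurd h (hM i hi)⟩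
  choose M hM using h
  refine ⟨Finset.univ.sup M, fun i hi => ⟨hM _ i ?_ (Or.inl rfl), hM _ i ?_ (Or.inr rfl)⟩⟩ <;>
    exact (Finset.le_sup (Finset.mem_univ _)).trans hi

theorem exists_isDominating : ∃ d, w.IsDominating d := by
  obtain ⟨M, hM⟩ := w.eventually_infOften
  obtain ⟨_, ⟨i, hi, rfl⟩, hmax⟩ := Set.exists_max_image
    {u | ∃ i ≥ M, w.an i = u} (fun u => (Z.label u).card) (Set.toFinite _)
    ⟨_, M, le_rfl, rfl⟩
  have hbelow : ∀ j ≥ i, Z.anc (w.an i) (w.lf j) ∧ Z.anc (w.an i) (w.an j) := by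
    intro j hj
    induction j, hj using Nat.le_induction with
    | base => exact ⟨(w.an_anchor i).1, Relation.ReflTransGen.refl⟩
    | succ j hj ih =>
      have hlf := ih.2.trans (w.lf_below j)
      refine ⟨hlf, ?_⟩
      rcases hlf.total (w.an_anchor (j + 1)).1 with h | h
      · exact h
      · rw [h.eq_of_card_le (hmax _ ⟨j + 1, by omega, rfl⟩)]
        exact Relation.ReflTransGen.refl
  refine ⟨w.an i, (hM i hi).2, fun u hu => ?_⟩
  obtain ⟨j, hj, rfl | rfl⟩ := hu i
  · exact (hbelow j hj).1
  · exact (hbelow j hj).2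

variable {w}

theorem IsDominating.eventually_anc {d : Z.V} (hd : w.IsDominating d) :
    ∃ M, ∀ i ≥ M, Z.anc d (w.an i) := by
  obtain ⟨M, hM⟩ := w.eventually_infOften
  exact ⟨M, fun i hi => hd.2 _ (hM i hi).2⟩

theorem IsDominating.subset_label {d : Z.V} (hd : w.IsDominating d) {D : Finset C}
    (hD : ∀ c ∈ D, ∀ M : ℕ, ∃ i ≥ M, c ∈ γ (π i)) : D ⊆ Z.label d := by
  intro c hc
  obtain ⟨M, hM⟩ := hd.eventually_anc
  obtain ⟨i, hi, hci⟩ := hD c hc M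
  exact (hM i hi).label_subset_s6 ((w.an_anchor i).2.1 hci)

/-- If the walk visits a non-leaf vertex infinitely often, it does so as an anchor node. -/
theorem InfOften.exists_an_eq {d c : Z.V} (hd : w.InfOften d) (hc : c ∈ Z.children d) (M : ℕ) :
    ∃ i ≥ M, w.an i = d := by
  obtain ⟨i, hi, h | h⟩ := hd M
  · have hleaf : Z.children d = ∅ := h ▸ w.lf_leaf i
    simp [hleaf] at hc
  · exact ⟨i, hi, h⟩

/-- Once below a vertex whose label contains all colors still to come, the walk stays there. -/
theorem anc_an_of_forall_subset {c : Z.V} {i : ℕ} (hc : Z.anc c (w.lf i))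
    (hγ : ∀ j ≥ i, γ (π j) ⊆ Z.label c) {j : ℕ} (hj : i ≤ j) : Z.anc c (w.an j) := by
  suffices Z.anc c (w.lf j) from (w.an_anchor j).2.2 c this (hγ j hj)
  induction j, hj using Nat.le_induction with
  | base => exact hc
  | succ j hj ih => exact ((w.an_anchor j).2.2 c ih (hγ j hj)).trans (w.lf_below j)

/-- A vertex visited infinitely often has no child below which the walk is caught. -/
theorem InfOften.not_anc_lf {d c : Z.V} (hd : w.InfOften d) (hc : c ∈ Z.children d) {i : ℕ}
    (hγ : ∀ j ≥ i, γ (π j) ⊆ Z.label c) : ¬ Z.anc c (w.lf i) := by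
  intro hci
  obtain ⟨j, hj, rfl⟩ := hd.exists_an_eq hc i
  exact not_anc_of_mem_children hc (anc_an_of_forall_subset hci hγ hj)

/-- As long as a walk below `d` does not visit `d`, it stays below the same child of `d`. -/
theorem anc_lf_of_an_ne {d c : Z.V} (hc : c ∈ Z.children d) {i j : ℕ} (hij : i ≤ j)
    (hbelow : ∀ k ≥ i, Z.anc d (w.an k)) (hne : ∀ k, i ≤ k → k < j → w.an k ≠ d)
    (hci : Z.anc c (w.lf i)) : Z.anc c (w.lf j) := by
  induction j, hij using Nat.le_induction with
  | base => exact hci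
  | succ j hj ih =>
    have hcj := ih fun k hk hkj => hne k hk (by omega)
    refine anc.trans ?_ (w.lf_below j)
    rcases hcj.total (w.an_anchor j).1 with h | h
    · exact h
    · rcases h.eq_or_anc_parent hc with h | h
      · rw [h]
        exact Relation.ReflTransGen.refl
      · exact absurd (h.antisymm (hbelow j hj)) (hne j hj (by omega))

/-- A walk with winning dominating vertex `d` visits all children of `d` again and again. -/
theorem IsDominating.exists_anc_lf (hnum : Function.Injective num) {d e : Z.V}
    (hd : w.IsDominating d) (hwin : Z.Winning d) (he : e ∈ Z.children d) (K : ℕ) :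
    ∃ i ≥ K, Z.anc e (w.lf i) := by
  obtain ⟨M, hM⟩ := hd.eventually_anc
  have hchild : ∀ i, w.an i = d → ∃ c ∈ Z.children d, Z.anc c (w.lf (i + 1)) := by
    rintro i rfl
    refine (w.lf_below i).exists_child fun h => ?_
    have hleaf := w.lf_leaf (i + 1)
    rw [← h, IsLeaf] at hleaf
    simp [hleaf] at he
  have hS : e ∈ {c | c ∈ Z.children d ∧ ∃ i ≥ max K M, Z.anc c (w.lf i)} := by
    refine mem_of_cyclicNext_closed hnum ?_ ?_ he
    · obtain ⟨i, hi, hid⟩ := hd.1.exists_an_eq he (max K M)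
      obtain ⟨c, hc, hci⟩ := hchild i hid
      exact ⟨c, hc, i + 1, by omega, hci⟩
    · rintro c ⟨hc, i, hi, hci⟩
      classical
      have hex := hd.1.exists_an_eq he i
      obtain ⟨hij, hjd⟩ := Nat.find_spec hex
      have hmin : ∀ k, i ≤ k → k < Nat.find hex → w.an k ≠ d :=
        fun k hik hk h => Nat.find_min hex hk ⟨hik, h⟩
      generalize Nat.find hex = j at hij hjd hmin
      obtain ⟨c', hc', hcj'⟩ := hchild j hjd
      have hcj := anc_lf_of_an_ne hc hij
        (fun k hk => hM k ((le_max_right K M).trans (hi.trans hk))) hmin hci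
      subst hjd
      exact ⟨c', ⟨hc', j + 1, by omega, hcj'⟩, w.fair j c c' hwin hc hcj hc' hcj'⟩
  obtain ⟨-, i, hi, hei⟩ := hS
  exact ⟨i, (le_max_left K M).trans hi, hei⟩

end InducedWalk

end ZielonkaTree

/-- From some point on, only colors that are visited infinitely often are visited. -/
theorem exists_forall_ge_colors_subset {C N : Type} [Fintype C] (γ : N → Finset C) (π : ℕ → N)
    {D : Finset C} (hD : ∀ c, (∀ M : ℕ, ∃ i ≥ M, c ∈ γ (π i)) → c ∈ D) :
    ∃ M, ∀ i ≥ M, γ (π i) ⊆ D := by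
  have h : ∀ c, ∃ M, ∀ i ≥ M, c ∈ γ (π i) → c ∈ D := by
    intro c
    by_cases hc : c ∈ D
    · exact ⟨0, fun _ _ _ => hc⟩
    · have hfin := mt (hD c) hc
      simp only [not_forall, not_exists, not_and] at hfin
      obtain ⟨M, hM⟩ := hfin
      exact ⟨M, fun i hi h => absurd h (hM i hi)⟩
  choose M hM using h
  exact ⟨Finset.univ.sup M, fun i hi c hc =>
    hM c i ((Finset.le_sup (Finset.mem_univ c)).trans hi) hc⟩

/-- A play `π` of an Emerson-Lei game with objective `α_{γ,φ}` is winning for the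
existential player (the set of colors visited infinitely often by `π` satisfies `φ`)
if and only if `π` induces some walk through the Zielonka tree `Z_φ` whose dominating
vertex is a winning vertex. -/
theorem play_winning_iff_induces_walk_with_winning_dominating_vertex
    {C N : Type} [Fintype C] [DecidableEq C] (φ : ELFormula C) (Z : ZielonkaTree C φ)
    (A : Arena N) (γ : N → Finset C)
    (num : Z.V → ℕ) (hnum : Function.Injective num)
    (π : ℕ → N) (hπ : A.IsPlay π) :
    ELObjective γ φ π ↔
      ∃ (w : Z.InducedWalk num γ π) (d : Z.V), w.IsDominating d ∧ Z.Winning d := by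
  obtain ⟨D, hD⟩ := (Set.toFinite {c : C | ∀ M : ℕ, ∃ i ≥ M, c ∈ γ (π i)}).exists_finset
  have hcoe : {c : C | ∀ M : ℕ, ∃ i ≥ M, c ∈ γ (π i)} = ↑D := Set.ext fun c => (hD c).symm
  rw [ELObjective, hcoe]
  obtain ⟨M, hM⟩ := exists_forall_ge_colors_subset γ π fun c => (hD c).mpr
  constructor
  · intro hsat
    obtain ⟨w, hw⟩ := ZielonkaTree.exists_inducedWalk num γ π D
    obtain ⟨d, hd⟩ := w.exists_isDominating
    refine ⟨w, d, hd, ?_⟩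
    by_contra hlose
    obtain ⟨c, hc, hDc⟩ := ZielonkaTree.exists_child_label_superset
      (hd.subset_label fun c => (hD c).mp) (iff_of_true hsat hlose)
    obtain ⟨i, hi, rfl⟩ := hd.1.exists_an_eq hc M
    obtain ⟨b, hb, hDb, hbi⟩ := hw i hlose ⟨c, hc, hDc⟩
    exact hd.1.not_anc_lf hb (fun j hj => (hM j (by omega)).trans hDb) hbi
  · rintro ⟨w, d, hd, hwin⟩
    by_contra hsat
    obtain ⟨c, hc, hDc⟩ := ZielonkaTree.exists_child_label_superset
      (hd.subset_label fun c => (hD c).mp) (iff_of_false hsat (not_not.mpr hwin))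
    obtain ⟨i, hi, hci⟩ := hd.exists_anc_lf hnum hwin hc M
    exact hd.1.not_anc_lf hc (fun j hj => (hM j (hi.trans hj)).trans hDc) hci
end

section
/- The solution ⟦X_r⟧ of the variable X_r of the Emerson-Lei equation system S_φ, where r is the root of the Zielonka tree Z_φ, equals the winning region of the existential player in the Emerson-Lei game G. -/
/-- Being a leaf is decidable. -/
instance ZielonkaTree.decIsLeaf {C : Type} [Fintype C] [DecidableEq C] {φ : ELFormula C}
    (Z : ZielonkaTree C φ) (t : Z.V) : Decidable (Z.IsLeaf t) := by
  have : DecidableEq Z.V := Z.decV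
  unfold ZielonkaTree.IsLeaf
  infer_instance

/-- The least fixpoint à la Knaster–Tarski: the intersection of all prefixpoints. -/
def klfp {α : Type} (f : Set α → Set α) : Set α := ⋂₀ {X | f X ⊆ X}

/-- The greatest fixpoint à la Knaster–Tarski: the union of all postfixpoints. -/
def kgfp {α : Type} (f : Set α → Set α) : Set α := ⋃₀ {X | X ⊆ f X}

/-- The controllable predecessor operator:
`CPre(X) = {v ∈ V∃ | E(v) ∩ X ≠ ∅} ∪ {v ∈ V∀ | E(v) ⊆ X}`. -/
def CPre {N : Type} (A : Arena N) (X : Set N) : Set N :=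
  {v | (v ∈ A.Vex ∧ (A.E v ∩ X).Nonempty) ∨ (v ∉ A.Vex ∧ A.E v ⊆ X)}

/-- The set `anc^s_t` of game nodes anchored at `s` relative to `t`: for `s = t` the
nodes `v` with `γ(v) ⊆ l(t)`; for a strict ancestor `s` of `t` the nodes `v` with
`γ(v) ⊆ l(s)` whose colors are not contained in the label of the child of `s` leading
to `t`. -/
def ancSet {C N : Type} [Fintype C] [DecidableEq C] {φ : ELFormula C}
    (Z : ZielonkaTree C φ) (γ : N → Finset C) (s t : Z.V) : Set N :=
  letI : DecidableEq Z.V := Z.decV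
  if s = t then {v | γ v ⊆ Z.label t}
  else {v | γ v ⊆ Z.label s ∧ ∀ c ∈ Z.children s, Z.anc c t → ¬ γ v ⊆ Z.label c}

open Classical in
/-- The nested Knaster–Tarski solution `⟦X_s⟧` of the Emerson-Lei equation system `S_φ`
with the values of the variables of strict ancestors of `s` given by `env`:
for a non-leaf losing vertex, `X_s =_LFP ⋃_{t ∈ R(s)} X_t`; for a non-leaf winning
vertex, `X_s =_GFP ⋂_{t ∈ R(s)} X_t`; and for a leaf,
`X_s =_η ⋃_{s' ≤ s} (anc^{s'}_s ∩ CPre(X_{s'}))`, where `η = GFP` for winning vertices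
and `η = LFP` for losing ones; variables are resolved from innermost to outermost. -/
noncomputable def ELSol {C N : Type} [Fintype C] [DecidableEq C] {φ : ELFormula C}
    (Z : ZielonkaTree C φ) (A : Arena N) (γ : N → Finset C)
    (s : Z.V) (env : Z.V → Set N) : Set N :=
  letI : DecidableEq Z.V := Z.decV
  let F : Set N → Set N := fun X =>
    let env' : Z.V → Set N := fun u => if u = s then X else env u
    if Z.IsLeaf s then
      ⋃ s', ⋃ (_ : Z.anc s' s), ancSet Z γ s' s ∩ CPre A (env' s')
    else if Z.Winning s then
      ⋂ t : {t : Z.V // t ∈ Z.children s}, ELSol Z A γ t.1 env'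
    else
      ⋃ t : {t : Z.V // t ∈ Z.children s}, ELSol Z A γ t.1 env'
  if Z.Winning s then kgfp F else klfp F
termination_by (Z.label s).card
decreasing_by all_goals exact Finset.card_lt_card (Z.child_maximal t.2).1.1

theorem WinsFrom.mono {N : Type} {A : Arena N} {α α' : (ℕ → N) → Prop} {v : N}
    (h : WinsFrom A α v) (hα : ∀ π, α π → α' π) : WinsFrom A α' v :=
  h.imp fun _ hσ => ⟨hσ.1, fun π hp h0 hc => hα π (hσ.2 π hp h0 hc)⟩

namespace Arena

variable {N : Type}

/-- The play `π` follows the strategy `σ` of the existential player. -/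
def Complies (A : Arena N) (σ : List N → N → N) (π : ℕ → N) : Prop :=
  ∀ i, π i ∈ A.Vex → π (i + 1) = σ ((List.range i).map π) (π i)

theorem exists_seq_of_history (f : List N → N → N) (v : N) :
    ∃ π : ℕ → N, π 0 = v ∧ ∀ i, π (i + 1) = f ((List.range i).map π) (π i) := by
  let s : ℕ → List N × N := fun n =>
    Nat.rec ([], v) (fun _ p => (p.1 ++ [p.2], f p.1 p.2)) n
  have hs : ∀ i, (s i).1 = (List.range i).map (fun j => (s j).2) := by
    intro i
    induction i with
    | zero => rfl
    | succ i ih =>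
      rw [List.range_succ, List.map_append, ← ih]
      rfl
  refine ⟨fun i => (s i).2, rfl, fun i => ?_⟩
  rw [← hs]

/-- A finite compliant play prefix extends to an infinite compliant play. -/
theorem exists_compliant_extension (A : Arena N) {σ : List N → N → N}
    (hσ : ∀ h u, u ∈ A.Vex → σ h u ∈ A.E u) (π : ℕ → N) (k : ℕ)
    (hplay : ∀ i < k, π (i + 1) ∈ A.E (π i))
    (hc : ∀ i < k, π i ∈ A.Vex → π (i + 1) = σ ((List.range i).map π) (π i)) :
    ∃ π', A.IsPlay π' ∧ A.Complies σ π' ∧ ∀ i ≤ k, π' i = π i := by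
  classical
  obtain ⟨π', h0, h1⟩ := exists_seq_of_history (fun h u =>
    if h.length < k then π (h.length + 1)
    else if u ∈ A.Vex then σ h u else (A.E_nonempty u).some) (π 0)
  have hag : ∀ i ≤ k, π' i = π i := by
    intro i hi
    cases i with
    | zero => exact h0
    | succ i =>
      rw [h1 i, if_pos (by simpa using hi)]
      simp
  refine ⟨π', fun i => ?_, fun i hi => ?_, hag⟩
  · by_cases hik : i < k
    · rw [hag i hik.le, hag (i + 1) hik]
      exact hplay i hik
    · rw [h1 i, if_neg (by simpa using hik)]
      split_ifs with hv
      · exact hσ _ _ hv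
      · exact (A.E_nonempty _).some_mem
  · by_cases hik : i < k
    · have hm : (List.range i).map π' = (List.range i).map π :=
        List.map_congr_left fun j hj => hag j ((List.mem_range.1 hj).le.trans hik.le)
      rw [hag i hik.le] at hi
      rw [hag i hik.le, hag (i + 1) hik, hm]
      exact hc i hik hi
    · rw [h1 i, if_neg (by simpa using hik), if_pos hi]

open Classical in
/-- The index and the starting time of the segment that contains time `i`, when the sequence `p`
is cut after every time at which it meets the set `O n` belonging to the current segment `n`. -/
noncomputable def seg (O : ℕ → Set N) (p : ℕ → N) : ℕ → ℕ × ℕ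
  | 0 => (0, 0)
  | i + 1 => if p i ∈ O (seg O p i).1 then ((seg O p i).1 + 1, i + 1) else seg O p i

section seg

variable {O : ℕ → Set N} {p q : ℕ → N} {i j : ℕ}

theorem seg_succ_of_mem (h : p i ∈ O (seg O p i).1) :
    seg O p (i + 1) = ((seg O p i).1 + 1, i + 1) := by
  rw [seg, if_pos h]

theorem seg_succ_of_notMem (h : p i ∉ O (seg O p i).1) : seg O p (i + 1) = seg O p i := by
  rw [seg, if_neg h]

theorem seg_congr (h : ∀ j < i, p j = q j) : seg O p i = seg O q i := by
  induction i with
  | zero => rfl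
  | succ i ih =>
    rw [seg, seg, ih fun j hj => h j (hj.trans i.lt_succ_self), h i i.lt_succ_self]

theorem seg_fst_le (O : ℕ → Set N) (p : ℕ → N) (i : ℕ) : (seg O p i).1 ≤ i := by
  induction i with
  | zero => exact le_rfl
  | succ i ih =>
    rw [seg]
    split_ifs
    · exact Nat.succ_le_succ ih
    · exact ih.trans i.le_succ

theorem seg_snd_le (O : ℕ → Set N) (p : ℕ → N) (i : ℕ) : (seg O p i).2 ≤ i := by
  induction i with
  | zero => exact le_rfl
  | succ i ih =>
    rw [seg]
    split_ifs
    · exact le_rfl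
    · exact ih.trans i.le_succ

theorem seg_eq_of_le (hj : (seg O p i).2 ≤ j) (hji : j ≤ i) : seg O p j = seg O p i := by
  induction i with
  | zero => rw [Nat.le_zero.1 hji]
  | succ i ih =>
    rcases hji.eq_or_lt with rfl | hlt
    · rfl
    by_cases h : p i ∈ O (seg O p i).1
    · rw [seg_succ_of_mem h] at hj
      exact absurd hj (not_le.2 hlt)
    · rw [seg_succ_of_notMem h] at hj ⊢
      exact ih hj (Nat.lt_succ_iff.1 hlt)

theorem notMem_of_seg (hj : (seg O p i).2 ≤ j) (hji : j < i) : p j ∉ O (seg O p i).1 := by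
  intro h
  have h1 := seg_eq_of_le hj hji.le
  have h2 := seg_eq_of_le (hj.trans j.le_succ) hji
  rw [← h1] at h
  rw [seg_succ_of_mem h, ← h1] at h2
  exact absurd (congrArg Prod.fst h2) (Nat.succ_ne_self _)

theorem seg_eq_of_ge (h : ∀ l, i ≤ l → l < j → p l ∉ O (seg O p i).1) (hij : i ≤ j) :
    seg O p j = seg O p i := by
  induction j, hij using Nat.le_induction with
  | base => rfl
  | succ j hij ih =>
    have hj := ih fun l hl hlj => h l hl (hlj.trans j.lt_succ_self)
    rw [seg_succ_of_notMem (by rw [hj]; exact h j hij j.lt_succ_self), hj]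

/-- If every segment is eventually left, then all segment indices occur. -/
theorem exists_seg_fst_eq (h : ∀ i, ∃ j ≥ i, p j ∈ O (seg O p i).1) (n : ℕ) :
    ∃ i, (seg O p i).1 = n ∧ p i ∈ O n := by
  classical
  have step : ∀ i, ∃ j, (seg O p j).1 = (seg O p i).1 ∧ p j ∈ O (seg O p i).1 := by
    intro i
    obtain ⟨hge, hmem⟩ := Nat.find_spec (h i)
    refine ⟨Nat.find (h i), ?_, hmem⟩
    rw [seg_eq_of_ge (fun l hl hlt hm => Nat.find_min (h i) hlt ⟨hl, hm⟩) hge]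
  induction n with
  | zero => exact step 0
  | succ n ih =>
    obtain ⟨i, hi, hm⟩ := ih
    rw [← hi] at hm
    have := step (i + 1)
    rwa [seg_succ_of_mem hm, hi] at this

end seg

/-- Strategies can be chained: play a strategy for `α 0`, switch to one for `α 1` after the first
visit to `O 0`, then to one for `α 2` after the next visit to `O 1`, and so on. -/
theorem winsFrom_chain (A : Arena N) (O : ℕ → Set N) (α : ℕ → (ℕ → N) → Prop)
    (h : ∀ n x, WinsFrom A (α n) x) (v : N) :
    WinsFrom A (fun π => π 0 = v ∧ ∀ i,
      (∃ π', α (seg O π i).1 π' ∧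
        ∀ j, (seg O π i).2 ≤ j → j ≤ i + 1 → π' (j - (seg O π i).2) = π j) ∧
      ((∀ j ≥ i, π j ∉ O (seg O π i).1) →
        α (seg O π i).1 (fun j => π ((seg O π i).2 + j)))) v := by
  choose σ hσ hα using h
  let r : List N → N → ℕ × ℕ := fun h u => seg O (fun i => h.getD i u) h.length
  let τ : List N → N → N := fun h u =>
    σ (r h u).1 (h.getD (r h u).2 u) (h.drop (r h u).2) u
  refine ⟨τ, fun h u hu => hσ _ _ _ _ hu, fun π hπ hπ0 hτ => ⟨hπ0, fun i => ?_⟩⟩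
  have hget : ∀ i, ∀ j ≤ i, ((List.range i).map π).getD j (π i) = π j := by
    intro i j hj
    rcases hj.eq_or_lt with rfl | hlt
    · rw [List.getD_eq_default _ _ (by simp)]
    · rw [List.getD_eq_getElem _ _ (by simpa using hlt)]
      simp
  have hr : ∀ i, r ((List.range i).map π) (π i) = seg O π i := by
    intro i
    show seg O _ _ = _
    rw [List.length_map, List.length_range]
    exact seg_congr fun j hj => hget i j hj.le
  have hdrop : ∀ i k, ((List.range i).map π).drop k =
      (List.range (i - k)).map (fun j => π (k + j)) := by
    intro i k
    apply List.ext_getElem <;> simp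
  have hcomp : ∀ l, π l ∈ A.Vex → π (l + 1) = σ (seg O π l).1 (π (seg O π l).2)
      ((List.range (l - (seg O π l).2)).map (fun j => π ((seg O π l).2 + j))) (π l) := by
    intro l hl
    rw [hτ l hl]
    show σ _ _ _ _ = _
    rw [hr, hget l _ (seg_snd_le O π l), hdrop]
  obtain ⟨n, k, hs⟩ : ∃ n k, seg O π i = (n, k) := ⟨_, _, rfl⟩
  have hk : k ≤ i := by have := seg_snd_le O π i; rwa [hs] at this
  have hcomp' : ∀ j, seg O π (k + j) = (n, k) → π (k + j) ∈ A.Vex → π (k + (j + 1)) =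
      σ n (π k) ((List.range j).map (fun j => π (k + j))) (π (k + j)) := by
    intro j hj hv
    have := hcomp (k + j) hv
    rw [hj] at this
    simpa [add_assoc] using this
  have hseg : ∀ j, k + j ≤ i → seg O π (k + j) = (n, k) := by
    intro j hj
    rw [seg_eq_of_le (by rw [hs]; exact Nat.le_add_right k j) hj, hs]
  rw [hs]
  constructor
  · obtain ⟨π', h1, h2, h3⟩ := A.exists_compliant_extension (hσ n (π k)) (fun j => π (k + j))
      (i + 1 - k) (fun j _ => hπ (k + j))
      (fun j hj hv => hcomp' j (hseg j (by omega)) hv)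
    refine ⟨π', hα n (π k) π' h1 (h3 0 (Nat.zero_le _)) h2, fun j hkj hji => ?_⟩
    dsimp only at hkj ⊢
    rw [h3 (j - k) (by omega), Nat.add_sub_cancel' hkj]
  · intro hout
    refine hα n (π k) _ (fun j => hπ (k + j)) rfl fun j hv => hcomp' j ?_ hv
    rcases le_total (k + j) i with hji | hij
    · exact hseg j hji
    · rw [seg_eq_of_ge (fun l hl _ => by rw [hs]; exact hout l hl) hij, hs]

/-- The objective to either never visit `O` and satisfy `β`, or to visit `O` and move from the
first visited node `u ∈ O` into `g u`. -/
def ExitObjective (β : (ℕ → N) → Prop) (O : Set N) (g : N → Set N) (π : ℕ → N) : Prop :=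
  ((∀ i, π i ∉ O) ∧ β π) ∨ ∃ j, (∀ i < j, π i ∉ O) ∧ π j ∈ O ∧ π (j + 1) ∈ g (π j)

theorem ExitObjective.mono {β : (ℕ → N) → Prop} {O : Set N} {g g' : N → Set N}
    (hg : ∀ u ∈ O, g u ⊆ g' u) {π : ℕ → N} (h : ExitObjective β O g π) :
    ExitObjective β O g' π :=
  h.imp id fun ⟨j, h1, h2, h3⟩ => ⟨j, h1, h2, hg _ h2 h3⟩

theorem winsFrom_exitObjective_univ (A : Arena N) (β : (ℕ → N) → Prop) (g : N → Set N) {v : N}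
    (hv : v ∈ CPre A (g v)) : WinsFrom A (ExitObjective β Set.univ g) v := by
  classical
  refine ⟨fun _ u => if h : (A.E u ∩ g u).Nonempty then h.some else (A.E_nonempty u).some,
    fun _ u _ => ?_, fun π hπ h0 hσ => ?_⟩
  · dsimp only
    split_ifs with h
    · exact h.some_mem.1
    · exact (A.E_nonempty u).some_mem
  · refine Or.inr ⟨0, by simp, trivial, ?_⟩
    rcases hv with ⟨hex, hne⟩ | ⟨_, hsub⟩
    · subst h0
      rw [hσ 0 hex]
      dsimp only
      rw [dif_pos hne]
      exact hne.some_mem.2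
    · have := hπ 0
      rw [h0] at this ⊢
      exact hsub this

theorem winsFrom_exitObjective_chain (A : Arena N) {β : (ℕ → N) → Prop}
    (htail : ∀ π k, β (fun i => π (k + i)) → β π) {O' : Set N} {g : N → Set N}
    (O : ℕ → Set N) (X : ℕ → Set N) (hO : ∀ n, O' ⊆ O n)
    (hX : ∀ n, ∀ x ∈ X n, WinsFrom A
      (ExitObjective β (O n) (fun u => {w | (u ∈ O' ∧ w ∈ g u) ∨ (u ∉ O' ∧ w ∈ X (n + 1))})) x)
    (hinf : ∀ π : ℕ → N, (∀ i, π i ∉ O') → (∀ n, ∃ i ≥ n, π i ∈ O n) → β π)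
    {v : N} (hv : v ∈ X 0) : WinsFrom A (ExitObjective β O' g) v := by
  classical
  let α : ℕ → (ℕ → N) → Prop := fun n π => π 0 ∈ X n → ExitObjective β (O n)
    (fun u => {w | (u ∈ O' ∧ w ∈ g u) ∨ (u ∉ O' ∧ w ∈ X (n + 1))}) π
  have hα : ∀ n x, WinsFrom A (α n) x := by
    intro n x
    by_cases hx : x ∈ X n
    · obtain ⟨σ, h1, h2⟩ := hX n x hx
      exact ⟨σ, h1, fun π hp h0 hc _ => h2 π hp h0 hc⟩
    · exact ⟨fun _ u => (A.E_nonempty u).some, fun _ u _ => (A.E_nonempty u).some_mem,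
        fun π _ h0 _ h => absurd (h0 ▸ h) hx⟩
  obtain ⟨σ, h1, h2⟩ := A.winsFrom_chain O α hα v
  refine ⟨σ, h1, fun π hp h0 hc => ?_⟩
  obtain ⟨-, hπ⟩ := h2 π hp h0 hc
  have step : ∀ i, π (seg O π i).2 ∈ X (seg O π i).1 → π i ∈ O (seg O π i).1 →
      (π i ∈ O' ∧ π (i + 1) ∈ g (π i)) ∨
        (π i ∉ O' ∧ π (i + 1) ∈ X ((seg O π i).1 + 1)) := by
    intro i hXi hOi
    obtain ⟨π', hα', hag⟩ := (hπ i).1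
    have hk := seg_snd_le O π i
    have hmin := fun j => notMem_of_seg (O := O) (p := π) (i := i) (j := j)
    generalize seg O π i = s at *
    obtain ⟨n, k⟩ := s
    dsimp only at *
    have hag' : ∀ j, k + j ≤ i + 1 → π' j = π (k + j) := fun j hj => by
      simpa using hag (k + j) (Nat.le_add_right k j) hj
    have hi : π' (i - k) = π i := hag i hk i.le_succ
    rcases hα' (by rw [hag' 0 (by omega)]; exact hXi) with ⟨hno, _⟩ | ⟨j, hj1, hj2, hj3⟩
    · exact absurd (hi ▸ hOi) (hno (i - k))
    · have hj : j = i - k := by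
        rcases lt_trichotomy j (i - k) with hlt | heq | hgt
        · rw [hag' j (by omega)] at hj2
          exact absurd hj2 (hmin (k + j) (by omega) (by omega))
        · exact heq
        · exact absurd (hi ▸ hOi) (hj1 _ hgt)
      subst hj
      rw [hi, hag' (i - k + 1) (by omega), show k + (i - k + 1) = i + 1 by omega] at hj3
      exact hj3
  have stay : ∀ i, (∀ j < i, π j ∉ O') → π (seg O π i).2 ∈ X (seg O π i).1 := by
    intro i hi
    induction i with
    | zero => exact h0 ▸ hv
    | succ i ih =>
      have ih := ih fun j hj => hi j (hj.trans i.lt_succ_self)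
      by_cases hm : π i ∈ O (seg O π i).1
      · rw [seg_succ_of_mem hm]
        rcases step i ih hm with h | h
        · exact absurd h.1 (hi i i.lt_succ_self)
        · exact h.2
      · rwa [seg_succ_of_notMem hm]
  by_cases hex : ∃ j, π j ∈ O'
  · have hj := Nat.find_spec hex
    have hmin : ∀ i < Nat.find hex, π i ∉ O' := fun i hi => Nat.find_min hex hi
    refine Or.inr ⟨Nat.find hex, hmin, hj, ?_⟩
    rcases step _ (stay _ hmin) (hO _ hj) with h | h
    · exact h.2
    · exact absurd hj h.1
  · push Not at hex
    refine Or.inl ⟨hex, ?_⟩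
    by_cases hlast : ∃ i, ∀ j ≥ i, π j ∉ O (seg O π i).1
    · obtain ⟨i, hi⟩ := hlast
      rcases (hπ i).2 hi (stay i fun j _ => hex j) with ⟨_, h⟩ | ⟨j, _, hj, _⟩
      · exact htail π _ h
      · rcases lt_or_ge ((seg O π i).2 + j) i with hlt | hge
        · exact absurd hj (notMem_of_seg (Nat.le_add_right _ _) hlt)
        · exact absurd hj (hi _ hge)
    · push Not at hlast
      refine hinf π hex fun n => ?_
      obtain ⟨i, rfl, hi⟩ := exists_seg_fst_eq hlast n
      exact ⟨i, seg_fst_le O π i, hi⟩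

/-- The arena with the roles of the two players exchanged. -/
def dual (A : Arena N) : Arena N := ⟨A.Vexᶜ, A.E, A.E_nonempty⟩

theorem CPre_dual_compl (A : Arena N) (X : Set N) : CPre A.dual Xᶜ = (CPre A X)ᶜ := by
  ext v
  by_cases hv : v ∈ A.Vex <;>
    simp [CPre, dual, hv, Set.Nonempty, Set.subset_def]

/-- The two players cannot both win the same node. -/
theorem not_winsFrom_dual (A : Arena N) {α : (ℕ → N) → Prop} {v : N} (h : WinsFrom A α v) :
    ¬ WinsFrom A.dual (fun π => ¬ α π) v := by
  classical
  rintro ⟨τ, hτ, hτw⟩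
  obtain ⟨σ, hσ, hσw⟩ := h
  obtain ⟨π, h0, hπ⟩ := exists_seq_of_history
    (fun h u => if u ∈ A.Vex then σ h u else τ h u) v
  have hp : A.IsPlay π := by
    intro i
    rw [hπ i]
    split_ifs with hv
    · exact hσ _ _ hv
    · exact hτ _ _ hv
  refine hτw π hp h0 (fun i hi => ?_) (hσw π hp h0 fun i hi => ?_)
  · rw [hπ i, if_neg hi]
  · rw [hπ i, if_pos hi]

end Arena

theorem compl_klfp {α : Type} (f : Set α → Set α) : (klfp f)ᶜ = kgfp fun X => (f Xᶜ)ᶜ := by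
  rw [klfp, kgfp, Set.compl_sInter]
  congr 1
  ext X
  simp only [Set.mem_image, Set.mem_ofPred_eq]
  constructor
  · rintro ⟨Y, hY, rfl⟩
    rwa [compl_compl, Set.compl_subset_compl]
  · intro h
    exact ⟨Xᶜ, Set.subset_compl_comm.1 h, compl_compl X⟩

theorem compl_kgfp {α : Type} (f : Set α → Set α) : (kgfp f)ᶜ = klfp fun X => (f Xᶜ)ᶜ := by
  have h := compl_klfp fun X => (f Xᶜ)ᶜ
  simp only [compl_compl] at h
  rw [← h, compl_compl]

theorem ELObjective_of_tail {N C : Type} {γ : N → Finset C} {φ : ELFormula C} (π : ℕ → N) (k : ℕ)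
    (h : ELObjective γ φ fun i => π (k + i)) : ELObjective γ φ π := by
  unfold ELObjective at h ⊢
  convert h using 3 with c
  constructor
  · intro hc M
    obtain ⟨i, hi, hm⟩ := hc (k + M)
    exact ⟨i - k, by omega, by dsimp only; rwa [Nat.add_sub_cancel' (by omega)]⟩
  · intro hc M
    obtain ⟨i, hi, hm⟩ := hc M
    exact ⟨k + i, by omega, hm⟩

namespace ZielonkaTree

variable {C : Type} [Fintype C] [DecidableEq C] {φ : ELFormula C} (Z : ZielonkaTree C φ)

theorem label_ssubset_of_mem_children {Z : ZielonkaTree C φ} {s t : Z.V}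
    (h : t ∈ Z.children s) : Z.label t ⊂ Z.label s :=
  (Z.child_maximal h).1.1

theorem label_subset_of_anc {Z : ZielonkaTree C φ} {s t : Z.V} (h : Z.anc s t) :
    Z.label t ⊆ Z.label s := by
  induction h with
  | refl => exact Finset.Subset.refl _
  | tail _ h ih => exact (label_ssubset_of_mem_children h).1.trans ih

theorem anc_iff_of_mem_children {Z : ZielonkaTree C φ} {s t u : Z.V} (h : t ∈ Z.children s) :
    Z.anc u t ↔ u = t ∨ Z.anc u s := by
  constructor
  · intro hu
    rcases Relation.ReflTransGen.cases_tail hu with rfl | ⟨w, hw, hwt⟩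
    · exact Or.inl rfl
    · exact Or.inr (Z.parent_unique hwt h ▸ hw)
  · rintro (rfl | hu)
    · exact Relation.ReflTransGen.refl
    · exact hu.tail h

variable {N : Type} (γ : N → Finset C)

theorem mem_ancSet_self {s : Z.V} {v : N} : v ∈ ancSet Z γ s s ↔ γ v ⊆ Z.label s := by
  simp [ancSet]

theorem mem_ancSet_of_ne {s t : Z.V} {v : N} (h : s ≠ t) : v ∈ ancSet Z γ s t ↔
    γ v ⊆ Z.label s ∧ ∀ c ∈ Z.children s, Z.anc c t → ¬ γ v ⊆ Z.label c := by
  simp [ancSet, h]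

theorem anc_and_mem_ancSet_of_subset {t u : Z.V} {v : N} (hv : γ v ⊆ Z.label t) :
    Z.anc u t ∧ v ∈ ancSet Z γ u t ↔ u = t := by
  constructor
  · rintro ⟨ha, hm⟩
    by_contra hne
    rw [mem_ancSet_of_ne Z γ hne] at hm
    rcases Relation.ReflTransGen.cases_head ha with h | ⟨c, hc, hct⟩
    · exact hne h
    · exact hm.2 c hc hct (hv.trans (label_subset_of_anc hct))
  · rintro rfl
    exact ⟨Relation.ReflTransGen.refl, (mem_ancSet_self Z γ).2 hv⟩

theorem anc_and_mem_ancSet_of_not_subset {s t u : Z.V} {v : N} (hst : t ∈ Z.children s)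
    (hv : ¬ γ v ⊆ Z.label t) :
    Z.anc u t ∧ v ∈ ancSet Z γ u t ↔ Z.anc u s ∧ v ∈ ancSet Z γ u s := by
  have hts : ¬ Z.anc t s := fun h =>
    (label_ssubset_of_mem_children hst).2 (label_subset_of_anc h)
  rw [anc_iff_of_mem_children hst]
  by_cases hut : u = t
  · subst hut
    rw [mem_ancSet_self]
    tauto
  rw [mem_ancSet_of_ne Z γ hut]
  by_cases hus : u = s
  · subst hus
    rw [mem_ancSet_self]
    have : ∀ c ∈ Z.children u, Z.anc c t → ¬ γ v ⊆ Z.label c := by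
      intro c hc hct
      rcases (anc_iff_of_mem_children hst).1 hct with rfl | h
      · exact hv
      · exact absurd (label_subset_of_anc h) (label_ssubset_of_mem_children hc).2
    tauto
  · rw [mem_ancSet_of_ne Z γ hus]
    have : ∀ c ∈ Z.children u, (Z.anc c t ↔ Z.anc c s) := by
      intro c hc
      rw [anc_iff_of_mem_children hst, or_iff_right]
      rintro rfl
      exact hus (Z.parent_unique hc hst)
    constructor
    · rintro ⟨h1, h2, h3⟩
      exact ⟨h1.resolve_left hut, h2, fun c hc hcs => h3 c hc ((this c hc).2 hcs)⟩
    · rintro ⟨h1, h2, h3⟩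
      exact ⟨Or.inr h1, h2, fun c hc hcs => h3 c hc ((this c hc).1 hcs)⟩

theorem exists_anchor_s8 (s : Z.V) (v : N) :
    ∃ s', ∀ u, Z.anc u s ∧ v ∈ ancSet Z γ u s ↔ u = s' := by
  induction Z.reach_root s with
  | refl =>
    exact ⟨Z.root, fun u => anc_and_mem_ancSet_of_subset Z γ
      (by rw [Z.root_label]; exact Finset.subset_univ _)⟩
  | @tail s t _ hst ih =>
    by_cases hv : γ v ⊆ Z.label t
    · exact ⟨t, fun u => anc_and_mem_ancSet_of_subset Z γ hv⟩
    · obtain ⟨s', hs'⟩ := ih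
      exact ⟨s', fun u => (anc_and_mem_ancSet_of_not_subset Z γ hst hv).trans (hs' u)⟩

/-- The anchor of the vertex `s` at the game node `v`. -/
noncomputable def anchor (s : Z.V) (v : N) : Z.V := (Z.exists_anchor_s8 γ s v).choose

theorem anc_and_mem_ancSet_iff {s u : Z.V} {v : N} :
    Z.anc u s ∧ v ∈ ancSet Z γ u s ↔ u = Z.anchor γ s v :=
  (Z.exists_anchor_s8 γ s v).choose_spec u

theorem anchor_eq_self_iff {s : Z.V} {v : N} : Z.anchor γ s v = s ↔ γ v ⊆ Z.label s := by
  rw [eq_comm, ← anc_and_mem_ancSet_iff, mem_ancSet_self]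
  exact and_iff_right Relation.ReflTransGen.refl

theorem anchor_of_mem_children {s t : Z.V} {v : N} (hst : t ∈ Z.children s)
    (hv : ¬ γ v ⊆ Z.label t) : Z.anchor γ t v = Z.anchor γ s v := by
  rw [← anc_and_mem_ancSet_iff, ← anc_and_mem_ancSet_of_not_subset Z γ hst hv,
    anc_and_mem_ancSet_iff]

/-- A set of colors inside the label of `s`, but inside the label of no child of `s`, is
classified like the label of `s`. -/
theorem sat_iff_of_forall_not_subset {s : Z.V} {D : Finset C} (hD : D ⊆ Z.label s)
    (hc : ∀ t ∈ Z.children s, ¬ D ⊆ Z.label t) : ELSat (↑D) φ ↔ Z.Winning s := by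
  by_contra hne
  have hcand : ELCand φ (Z.label s) D := by
    refine ⟨hD.ssubset_of_ne ?_, by unfold Winning at hne; tauto⟩
    rintro rfl
    exact hne Iff.rfl
  obtain ⟨D', hDD', hmax⟩ := (Set.toFinite {D | ELCand φ (Z.label s) D}).exists_le_maximal hcand
  obtain ⟨t, ht, hl⟩ := Z.child_exists
    (⟨hmax.1, fun D'' h'' hsub => hmax.eq_of_le h'' hsub⟩ : ELMaxCand φ (Z.label s) D')
  exact hc t ht (hl ▸ hDD')

/-- The Zielonka tree of the negated formula. -/
abbrev neg : ZielonkaTree C φ.not where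
  V := Z.V
  root := Z.root
  children := Z.children
  label := Z.label
  root_label := Z.root_label
  reach_root := Z.reach_root
  parent_unique := Z.parent_unique
  root_not_child := Z.root_not_child
  child_maximal := fun s t h => by
    simpa only [ELMaxCand, ELCand, ELSat, not_iff_not] using Z.child_maximal h
  child_exists := fun s D h => Z.child_exists (by
    simpa only [ELMaxCand, ELCand, ELSat, not_iff_not] using h)
  child_label_inj := Z.child_label_inj

/-- The game nodes with a color outside the label of `s`. -/
def outside (s : Z.V) : Set N := {v | ¬ γ v ⊆ Z.label s}

open Classical in
/-- The operator whose extremal fixpoint is `ELSol`. -/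
noncomputable def solStep (A : Arena N) (s : Z.V) (env : Z.V → Set N) (X : Set N) : Set N :=
  if Z.IsLeaf s then {v | v ∈ CPre A (Function.update env s X (Z.anchor γ s v))}
  else if Z.Winning s then
    ⋂ t : {t : Z.V // t ∈ Z.children s}, ELSol Z A γ t.1 (Function.update env s X)
  else
    ⋃ t : {t : Z.V // t ∈ Z.children s}, ELSol Z A γ t.1 (Function.update env s X)

open Classical in
theorem ELSol_eq (A : Arena N) (s : Z.V) (env : Z.V → Set N) : ELSol Z A γ s env =
    if Z.Winning s then kgfp (Z.solStep γ A s env) else klfp (Z.solStep γ A s env) := by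
  have hupd : ∀ X, (fun u => if u = s then X else env u) = Function.update env s X := by
    intro X
    ext u
    simp [Function.update_apply]
  have hleaf : ∀ e : Z.V → Set N, (⋃ s', ⋃ (_ : Z.anc s' s), ancSet Z γ s' s ∩ CPre A (e s')) =
      {v | v ∈ CPre A (e (Z.anchor γ s v))} := by
    intro e
    ext v
    simp only [Set.mem_iUnion, Set.mem_inter_iff, Set.mem_ofPred_eq, exists_prop, ← and_assoc,
      anc_and_mem_ancSet_iff, exists_eq_left]
  have hstep : Z.solStep γ A s env = fun X => Z.solStep γ A s env X := rfl
  rw [ELSol, hstep]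
  simp only [solStep, hupd, hleaf, Function.update_apply]

theorem neg_anchor (s : Z.V) (v : N) : Z.neg.anchor γ s v = Z.anchor γ s v :=
  (Z.anc_and_mem_ancSet_iff γ).1 ((Z.neg.anc_and_mem_ancSet_iff γ (s := s) (v := v)).2 rfl)

theorem ELSol_neg_dual (A : Arena N) (s : Z.V) (env : Z.V → Set N) :
    ELSol Z.neg A.dual γ s (fun u => (env u)ᶜ) = (ELSol Z A γ s env)ᶜ := by
  induction hn : (Z.label s).card using Nat.strong_induction_on generalizing s env with
  | _ n ih =>
    subst hn
    have hupd : ∀ X, Function.update (fun u => (env u)ᶜ) s X =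
        fun u => (Function.update env s Xᶜ u)ᶜ := by
      intro X
      ext1 u
      by_cases hu : u = s <;> simp [hu]
    have hsub : ∀ (t : {t : Z.V // t ∈ Z.children s}) X,
        ELSol Z.neg A.dual γ t.1 (Function.update (fun u => (env u)ᶜ) s X) =
          (ELSol Z A γ t.1 (Function.update env s Xᶜ))ᶜ := by
      intro t X
      rw [hupd]
      exact ih _ (Finset.card_lt_card (label_ssubset_of_mem_children t.2)) _ _ rfl
    have hstep : Z.neg.solStep γ A.dual s (fun u => (env u)ᶜ) =
        fun X => (Z.solStep γ A s env Xᶜ)ᶜ := by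
      ext1 X
      by_cases hl : Z.IsLeaf s
      · have hl' : Z.neg.IsLeaf s := hl
        rw [solStep, solStep, if_pos hl, if_pos hl']
        ext v
        rw [Set.mem_ofPred_eq, neg_anchor]
        have := congrFun (hupd X) (Z.anchor γ s v)
        rw [show Function.update (fun u => (env u)ᶜ) s X (Z.anchor γ s v) = _ from this,
          Arena.CPre_dual_compl]
        rfl
      · have hl' : ¬ Z.neg.IsLeaf s := hl
        rw [solStep, solStep, if_neg hl, if_neg hl']
        by_cases hw : Z.Winning s
        · have hw' : ¬ Z.neg.Winning s := not_not.2 hw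
          rw [if_pos hw, if_neg hw', Set.compl_iInter]
          exact Set.iUnion_congr fun t => hsub t X
        · have hw' : Z.neg.Winning s := hw
          rw [if_neg hw, if_pos hw', Set.compl_iUnion]
          exact Set.iInter_congr fun t => hsub t X
    rw [ELSol_eq, ELSol_eq, hstep]
    by_cases hw : Z.Winning s
    · have hw' : ¬ Z.neg.Winning s := not_not.2 hw
      rw [if_pos hw, if_neg hw', compl_kgfp]
    · have hw' : Z.neg.Winning s := hw
      rw [if_neg hw, if_pos hw', compl_klfp]

/-- A play that stays inside the label of a winning vertex `s`, and leaves the label of each child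
of `s` again and again, satisfies the objective. -/
theorem ELObjective_of_winning {s : Z.V} (hs : Z.Winning s) {π : ℕ → N}
    (hin : ∀ i, π i ∉ Z.outside γ s)
    (hout : ∀ t ∈ Z.children s, ∀ n, ∃ i ≥ n, π i ∈ Z.outside γ t) : ELObjective γ φ π := by
  classical
  let D : Finset C := Finset.univ.filter fun c => ∀ M : ℕ, ∃ i ≥ M, c ∈ γ (π i)
  have hD : {c : C | ∀ M : ℕ, ∃ i ≥ M, c ∈ γ (π i)} = ↑D := by
    ext c
    simp [D]
  rw [ELObjective, hD, Z.sat_iff_of_forall_not_subset (s := s)]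
  · exact hs
  · intro c hc
    obtain ⟨i, _, hi⟩ := (Finset.mem_filter.1 hc).2 0
    exact not_not.1 (hin i) hi
  · intro t ht hDt
    have hM : ∀ c, ∃ M, c ∉ Z.label t → ∀ i ≥ M, c ∉ γ (π i) := by
      intro c
      by_cases hc : c ∈ Z.label t
      · exact ⟨0, fun h => absurd hc h⟩
      · have : c ∉ D := fun h => hc (hDt h)
        simp only [D, Finset.mem_filter, Finset.mem_univ, true_and] at this
        push Not at this
        exact this.imp fun M hM _ => hM
    choose M hM using hM
    obtain ⟨i, hi, hmem⟩ := hout t ht (Finset.univ.sup M)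
    refine hmem fun c hc => ?_
    by_contra hct
    exact hM c hct i ((Finset.le_sup (Finset.mem_univ c)).trans hi) hc

theorem outside_subset_of_mem_children {s t : Z.V} (h : t ∈ Z.children s) :
    Z.outside γ s ⊆ Z.outside γ t :=
  fun _ hv hvt => hv (hvt.trans (label_ssubset_of_mem_children h).1)

theorem winsFrom_of_mem_ELSol (A : Arena N) (s : Z.V) (env : Z.V → Set N) {v : N}
    (hv : v ∈ ELSol Z A γ s env) : WinsFrom A (Arena.ExitObjective (ELObjective γ φ)
      (Z.outside γ s) (fun u => env (Z.anchor γ s u))) v := by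
  induction hn : (Z.label s).card using Nat.strong_induction_on generalizing s env v with
  | _ n ih =>
    subst hn
    have hg : ∀ X u, Function.update env s X (Z.anchor γ s u) =
        {w | (u ∈ Z.outside γ s ∧ w ∈ env (Z.anchor γ s u)) ∨ (u ∉ Z.outside γ s ∧ w ∈ X)} := by
      intro X u
      by_cases hu : u ∈ Z.outside γ s
      · have : Z.anchor γ s u ≠ s := fun h => hu ((Z.anchor_eq_self_iff γ).1 h)
        simp [hu, this]
      · have : Z.anchor γ s u = s := (Z.anchor_eq_self_iff γ).2 (not_not.1 hu)
        simp [hu, this]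
    have hleaf : ∀ X, ∀ x ∈ Z.solStep γ A s env X, Z.IsLeaf s →
        WinsFrom A (Arena.ExitObjective (ELObjective γ φ) Set.univ
          fun u => Function.update env s X (Z.anchor γ s u)) x := by
      intro X x hx hl
      rw [solStep, if_pos hl] at hx
      exact A.winsFrom_exitObjective_univ _ _ hx
    have hchild : ∀ X, ∀ t ∈ Z.children s, ∀ x ∈ ELSol Z A γ t (Function.update env s X),
        WinsFrom A (Arena.ExitObjective (ELObjective γ φ) (Z.outside γ t)
          fun u => Function.update env s X (Z.anchor γ s u)) x := by
      intro X t ht x hx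
      refine (ih _ (Finset.card_lt_card (label_ssubset_of_mem_children ht)) _ _ hx rfl).mono
        fun π => Arena.ExitObjective.mono fun u hu => ?_
      rw [Z.anchor_of_mem_children γ ht hu]
    rw [ELSol_eq] at hv
    by_cases hw : Z.Winning s
    · rw [if_pos hw] at hv
      obtain ⟨X, hX, hvX⟩ := hv
      obtain ⟨O, hO, hwin, hrep⟩ : ∃ O : ℕ → Set N, (∀ n, Z.outside γ s ⊆ O n) ∧
          (∀ n, ∀ x ∈ X, WinsFrom A (Arena.ExitObjective (ELObjective γ φ) (O n)
            fun u => Function.update env s X (Z.anchor γ s u)) x) ∧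
          ∀ t ∈ Z.children s, ∀ n, ∃ m ≥ n, O m = Z.outside γ t := by
        by_cases hl : Z.IsLeaf s
        · refine ⟨fun _ => Set.univ, fun _ => Set.subset_univ _,
            fun _ x hx => hleaf X x (hX hx) hl, fun t ht => ?_⟩
          rw [IsLeaf] at hl
          simp [hl] at ht
        · obtain ⟨t₀, ht₀⟩ := Finset.nonempty_iff_ne_empty.2 hl
          have : Nonempty {t : Z.V // t ∈ Z.children s} := ⟨⟨t₀, ht₀⟩⟩
          obtain ⟨f, hf⟩ := exists_surjective_nat {t : Z.V // t ∈ Z.children s}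
          refine ⟨fun n => Z.outside γ (f n.unpair.1).1,
            fun n => Z.outside_subset_of_mem_children γ (f n.unpair.1).2, fun n x hx => ?_,
            fun t ht n => ?_⟩
          · have := hX hx
            rw [solStep, if_neg hl, if_pos hw] at this
            exact hchild X _ (f n.unpair.1).2 x (Set.mem_iInter.1 this _)
          · obtain ⟨m, hm⟩ := hf ⟨t, ht⟩
            exact ⟨Nat.pair m n, Nat.right_le_pair m n, by simp [hm]⟩
      simp only [hg] at hwin
      refine A.winsFrom_exitObjective_chain ELObjective_of_tail O (fun _ => X) hO hwin
        (fun π hin hout => Z.ELObjective_of_winning γ hw hin fun t ht n => ?_) hvX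
      obtain ⟨m, hm, hOm⟩ := hrep t ht n
      obtain ⟨i, hi, hmem⟩ := hout m
      exact ⟨i, hm.trans hi, hOm ▸ hmem⟩
    · rw [if_neg hw] at hv
      let W : Set N := {x | WinsFrom A (Arena.ExitObjective (ELObjective γ φ)
        (Z.outside γ s) (fun u => env (Z.anchor γ s u))) x}
      refine hv W fun x hx => ?_
      obtain ⟨O, hO, hwin⟩ : ∃ O : Set N, Z.outside γ s ⊆ O ∧
          WinsFrom A (Arena.ExitObjective (ELObjective γ φ) O
            fun u => Function.update env s W (Z.anchor γ s u)) x := by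
        by_cases hl : Z.IsLeaf s
        · exact ⟨Set.univ, Set.subset_univ _, hleaf W x hx hl⟩
        · rw [solStep, if_neg hl, if_neg hw] at hx
          obtain ⟨t, ht⟩ := Set.mem_iUnion.1 hx
          exact ⟨_, Z.outside_subset_of_mem_children γ t.2, hchild W _ t.2 x ht⟩
      simp only [hg] at hwin
      refine A.winsFrom_exitObjective_chain ELObjective_of_tail
        (fun n => Nat.casesOn n O fun _ => Z.outside γ s)
        (fun n => Nat.casesOn n {x} fun _ => W) (fun n => ?_) (fun n y hy => ?_)
        (fun π hin hout => ?_) (Set.mem_singleton x)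
      · cases n with
        | zero => exact hO
        | succ n => exact subset_rfl
      · cases n with
        | zero =>
          obtain rfl : y = x := hy
          exact hwin
        | succ n =>
          exact WinsFrom.mono hy fun π =>
            Arena.ExitObjective.mono fun u hu w h => Or.inl ⟨hu, h⟩
      · obtain ⟨i, _, hi⟩ := hout 1
        exact absurd hi (hin i)

theorem winsFrom_of_mem_ELSol_root (A : Arena N) (env : Z.V → Set N) {v : N}
    (hv : v ∈ ELSol Z A γ Z.root env) : WinsFrom A (ELObjective γ φ) v := by
  refine (Z.winsFrom_of_mem_ELSol γ A Z.root env hv).mono fun π h => ?_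
  rcases h with h | ⟨j, _, hj, _⟩
  · exact h.2
  · exact absurd (by rw [Z.root_label]; exact Finset.subset_univ _) hj

end ZielonkaTree

/-- The solution `⟦X_r⟧` of the root variable of the Emerson-Lei equation system `S_φ`
is the winning region of the existential player in the Emerson-Lei game `G`. -/
theorem ELSol_root_eq_winning_region
    {C N : Type} [Fintype C] [DecidableEq C] (φ : ELFormula C) (Z : ZielonkaTree C φ)
    (A : Arena N) (γ : N → Finset C) :
    ELSol Z A γ Z.root (fun _ => ∅) = {v | WinsFrom A (ELObjective γ φ) v} := by
  ext v
  refine ⟨fun hv => Z.winsFrom_of_mem_ELSol_root γ A _ hv, fun hv => ?_⟩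
  by_contra hn
  rw [← Set.mem_compl_iff, ← Z.ELSol_neg_dual γ A] at hn
  exact A.not_winsFrom_dual hv (Z.neg.winsFrom_of_mem_ELSol_root γ A.dual _ hn)
end

section
/- Let (V, V∃, V∀, E) be a game arena and f ⊆ V a set of accepting nodes, with the Büchi objective consisting of all plays that visit f infinitely often. Then the winning region W∃ of the existential player equals the nested fixpoint νX₁.μX₂.((f ∩ CPre(X₁)) ∪ ((V∖f) ∩ CPre(X₂))), i.e., the solution of the equation system X₁ =_{GFP} X₂, X₂ =_{LFP} (f ∩ CPre(X₁)) ∪ ((V∖f) ∩ CPre(X₂)). -/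
theorem CPre_mono {N : Type} (A : Arena N) {X Y : Set N} (h : X ⊆ Y) : CPre A X ⊆ CPre A Y := by
  rintro v (⟨hv, u, hu, hX⟩ | ⟨hv, hX⟩)
  · exact Or.inl ⟨hv, u, hu, h hX⟩
  · exact Or.inr ⟨hv, hX.trans h⟩

/-- In a finite arena, `CPre` preserves unions of increasing sequences of sets. -/
theorem CPre_iUnion_subset {N : Type} [Finite N] (A : Arena N) {Y : ℕ → Set N}
    (hY : Monotone Y) : CPre A (⋃ n, Y n) ⊆ ⋃ n, CPre A (Y n) := by
  rintro v (⟨hv, u, hu, hX⟩ | ⟨hv, hX⟩)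
  · obtain ⟨n, hn⟩ := Set.mem_iUnion.1 hX
    exact Set.mem_iUnion.2 ⟨n, Or.inl ⟨hv, u, hu, hn⟩⟩
  · obtain ⟨n, hn⟩ := hY.directed_le.exists_mem_subset_of_finset_subset_biUnion
      (s := (Set.toFinite (A.E v)).toFinset) (by simpa using hX)
    rw [Set.Finite.coe_toFinset] at hn
    exact Set.mem_iUnion.2 ⟨n, Or.inr ⟨hv, hn⟩⟩

/-- The strategy `σ` wins from `v` for the objective of visiting `f` infinitely often. -/
def BuchiWinning {N : Type} (A : Arena N) (f : Set N) (σ : List N → N → N) (v : N) : Prop :=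
  (∀ h u, u ∈ A.Vex → σ h u ∈ A.E u) ∧
    ∀ π : ℕ → N, A.IsPlay π → π 0 = v →
      (∀ i, π i ∈ A.Vex → π (i + 1) = σ ((List.range i).map π) (π i)) →
        ∀ M : ℕ, ∃ i ≥ M, π i ∈ f

/-- After one compliant move, the residual of a winning strategy is winning. -/
theorem BuchiWinning.residual {N : Type} {A : Arena N} {f : Set N} {σ : List N → N → N}
    {v u : N} (hσ : BuchiWinning A f σ v) (hu : u ∈ A.E v) (hc : v ∈ A.Vex → u = σ [] v) :
    BuchiWinning A f (fun h => σ (v :: h)) u := by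
  refine ⟨fun h w hw => hσ.1 _ w hw, fun π hπ h0 hcomp M => ?_⟩
  let ρ : ℕ → N := fun n => Nat.casesOn n v π
  have hρ : A.IsPlay ρ := by
    rintro (_ | i)
    · change π 0 ∈ A.E v
      rwa [h0]
    · exact hπ i
  have hρc : ∀ i, ρ i ∈ A.Vex → ρ (i + 1) = σ ((List.range i).map ρ) (ρ i) := by
    rintro (_ | i) hi
    · change π 0 = _
      rw [h0]
      exact hc hi
    · rw [List.range_succ_eq_map, List.map_cons, List.map_map]
      exact hcomp i hi
  obtain ⟨i, hi, hf⟩ := hσ.2 ρ hρ rfl hρc (M + 1)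
  obtain ⟨j, rfl⟩ : ∃ j, i = j + 1 := ⟨i - 1, by omega⟩
  exact ⟨j, by omega, hf⟩

theorem BuchiWinning.mem_CPre {N : Type} {A : Arena N} {f : Set N} {σ : List N → N → N}
    {v : N} (hσ : BuchiWinning A f σ v) : v ∈ CPre A {v | ∃ σ, BuchiWinning A f σ v} := by
  by_cases hv : v ∈ A.Vex
  · exact Or.inl ⟨hv, σ [] v, hσ.1 _ _ hv, _, hσ.residual (hσ.1 _ _ hv) fun _ => rfl⟩
  · exact Or.inr ⟨hv, fun u hu => ⟨_, hσ.residual hu fun h => absurd h hv⟩⟩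

/-- A node from which the existential player wins lies in every prefixpoint of the inner
operator at the winning region. -/
theorem BuchiWinning.mem_of_prefixpoint {N : Type} {A : Arena N} {f Y : Set N}
    (hY : f ∩ CPre A {v | ∃ σ, BuchiWinning A f σ v} ∪ fᶜ ∩ CPre A Y ⊆ Y)
    {σ : List N → N → N} {v : N} (hσ : BuchiWinning A f σ v) : v ∈ Y := by
  classical
  by_contra hv
  have hf : ∀ {ρ u}, BuchiWinning A f ρ u → u ∉ Y → u ∉ f := fun hρ hu huf =>
    hu (hY (Or.inl ⟨huf, hρ.mem_CPre⟩))
  have hτ : ∀ u, ∃ w ∈ A.E u, (u ∉ A.Vex → u ∉ f → u ∉ Y → w ∉ Y) := by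
    intro u
    by_cases h : A.E u ⊆ Y
    · obtain ⟨w, hw⟩ := A.E_nonempty u
      exact ⟨w, hw, fun h1 h2 h3 => absurd (hY (Or.inr ⟨h2, Or.inr ⟨h1, h⟩⟩)) h3⟩
    · obtain ⟨w, hw, hwY⟩ := Set.not_subset.1 h
      exact ⟨w, hw, fun _ _ _ => hwY⟩
  choose τ hτE hτY using hτ
  let next : (List N → N → N) × N → N := fun p => if p.2 ∈ A.Vex then p.1 [] p.2 else τ p.2
  let s : ℕ → (List N → N → N) × N := fun n =>
    Nat.rec (σ, v) (fun _ p => (fun h => p.1 (p.2 :: h), next p)) n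
  let π : ℕ → N := fun n => (s n).2
  have hhist : ∀ i h, (s i).1 h = σ ((List.range i).map π ++ h) := by
    intro i
    induction i with
    | zero => intro h; rfl
    | succ i ih =>
      intro h
      change (s i).1 (π i :: h) = _
      rw [ih, List.range_succ]
      simp
  have hcomp : ∀ i, π i ∈ A.Vex → π (i + 1) = (s i).1 [] (π i) := fun i hi => if_pos hi
  have hmove : ∀ i, BuchiWinning A f (s i).1 (π i) → π (i + 1) ∈ A.E (π i) := by
    intro i hi
    by_cases hV : π i ∈ A.Vex
    · rw [hcomp i hV]
      exact hi.1 _ _ hV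
    · rw [show π (i + 1) = τ (π i) from if_neg hV]
      exact hτE _
  have key : ∀ i, BuchiWinning A f (s i).1 (π i) ∧ π i ∉ Y := by
    intro i
    induction i with
    | zero => exact ⟨hσ, hv⟩
    | succ i ih =>
      refine ⟨ih.1.residual (hmove i ih.1) (hcomp i), ?_⟩
      have hnf := hf ih.1 ih.2
      by_cases hV : π i ∈ A.Vex
      · exact fun h => ih.2 (hY (Or.inr ⟨hnf, Or.inl ⟨hV, _, hmove i ih.1, h⟩⟩))
      · rw [show π (i + 1) = τ (π i) from if_neg hV]
        exact hτY _ hV hnf ih.2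
  obtain ⟨i, -, hi⟩ := hσ.2 π (fun i => hmove i (key i).1) rfl
    (fun i hi => by rw [hcomp i hi, hhist, List.append_nil]) 0
  exact hf (key i).1 (key i).2 hi

/-- If every node of `L` can be controlled into `L`, with decreasing rank outside `f`, then
the existential player wins from `L`. -/
theorem exists_buchiWinning_of_rank {N : Type} {A : Arena N} {f L : Set N} (r : N → ℕ)
    (hL : ∀ v ∈ L, v ∈ CPre A {u | u ∈ L ∧ (v ∉ f → r u < r v)}) {v : N} (hv : v ∈ L) :
    ∃ σ, BuchiWinning A f σ v := by
  have hτ : ∀ u, ∃ w ∈ A.E u, (u ∈ A.Vex → u ∈ L → w ∈ L ∧ (u ∉ f → r w < r u)) := by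
    intro u
    by_cases hu : u ∈ L
    · rcases hL u hu with ⟨-, w, hw, hwL⟩ | ⟨hV, -⟩
      · exact ⟨w, hw, fun _ _ => hwL⟩
      · obtain ⟨w, hw⟩ := A.E_nonempty u
        exact ⟨w, hw, fun h => absurd h hV⟩
    · obtain ⟨w, hw⟩ := A.E_nonempty u
      exact ⟨w, hw, fun _ h => absurd h hu⟩
  choose τ hτE hτL using hτ
  refine ⟨fun _ => τ, fun _ u _ => hτE u, fun π hπ h0 hcomp => ?_⟩
  have hstep : ∀ i, π i ∈ L → π (i + 1) ∈ L ∧ (π i ∉ f → r (π (i + 1)) < r (π i)) := by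
    intro i hi
    by_cases hV : π i ∈ A.Vex
    · rw [hcomp i hV]
      exact hτL _ hV hi
    · rcases hL _ hi with ⟨h, -⟩ | ⟨-, h⟩
      · exact absurd h hV
      · exact h (hπ i)
  have hmem : ∀ i, π i ∈ L := by
    intro i
    induction i with
    | zero => rwa [h0]
    | succ i ih => exact (hstep i ih).1
  intro M
  induction hn : r (π M) using Nat.strong_induction_on generalizing M with
  | _ n ih =>
    by_cases hf : π M ∈ f
    · exact ⟨M, le_rfl, hf⟩
    · obtain ⟨i, hi, hif⟩ := ih _ (hn ▸ (hstep M (hmem M)).2 hf) (M + 1) rfl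
      exact ⟨i, by omega, hif⟩

/-- Every postfixpoint of the outer operator is contained in a ranked set as in
`exists_buchiWinning_of_rank`. -/
theorem exists_rank_of_postfixpoint {N : Type} [Finite N] {A : Arena N} {f X : Set N}
    (hX : X ⊆ klfp (fun Y => f ∩ CPre A X ∪ fᶜ ∩ CPre A Y)) :
    ∃ (L : Set N) (r : N → ℕ), X ⊆ L ∧
      ∀ v ∈ L, v ∈ CPre A {u | u ∈ L ∧ (v ∉ f → r u < r v)} := by
  let F : Set N → Set N := fun Y => f ∩ CPre A X ∪ fᶜ ∩ CPre A Y
  have hF : Monotone F := fun Y Z h =>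
    Set.union_subset_union_right _ (Set.inter_subset_inter_right _ (CPre_mono A h))
  let Y : ℕ → Set N := fun n => F^[n] ∅
  have hYs : ∀ n, Y (n + 1) = F (Y n) := fun n => Function.iterate_succ_apply' F n ∅
  have hYm : Monotone Y := hF.monotone_iterate_of_le_map (Set.empty_subset _)
  have hXL : X ⊆ ⋃ n, Y n := by
    refine hX.trans (Set.sInter_subset_of_mem ?_)
    rintro v (h | ⟨hf, h⟩)
    · exact Set.mem_iUnion.2 ⟨1, by rw [hYs]; exact Or.inl h⟩
    · obtain ⟨n, hn⟩ := Set.mem_iUnion.1 (CPre_iUnion_subset A hYm h)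
      exact Set.mem_iUnion.2 ⟨n + 1, by rw [hYs]; exact Or.inr ⟨hf, hn⟩⟩
  refine ⟨⋃ n, Y n, fun v => sInf {n | v ∈ Y n}, hXL, fun v hv => ?_⟩
  have hr : v ∈ Y (sInf {n | v ∈ Y n}) :=
    Nat.sInf_mem (s := {n | v ∈ Y n}) (Set.mem_iUnion.1 hv)
  beta_reduce
  rcases hn : sInf {n | v ∈ Y n} with _ | n
  · rw [hn] at hr
    exact absurd hr (Set.notMem_empty v)
  · rw [hn, hYs] at hr
    rcases hr with ⟨hf, h⟩ | ⟨-, h⟩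
    · have hs : X ⊆ {u | u ∈ (⋃ n, Y n) ∧ (v ∉ f → sInf {n | u ∈ Y n} < n + 1)} :=
        fun u hu => ⟨hXL hu, fun h => absurd hf h⟩
      exact CPre_mono A hs h
    · have hs : Y n ⊆ {u | u ∈ (⋃ n, Y n) ∧ (v ∉ f → sInf {n | u ∈ Y n} < n + 1)} :=
        fun u hu => ⟨Set.mem_iUnion.2 ⟨n, hu⟩, fun _ => Nat.lt_succ_of_le (Nat.sInf_le hu)⟩
      exact CPre_mono A hs h

/-- For the Büchi objective given by a set `f` of accepting nodes (plays visiting `f`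
infinitely often), the winning region of the existential player is the nested fixpoint
`νX₁.μX₂.((f ∩ CPre(X₁)) ∪ ((V∖f) ∩ CPre(X₂)))`, i.e. the solution of the equation
system `X₁ =_GFP X₂`, `X₂ =_LFP (f ∩ CPre X₁) ∪ ((V∖f) ∩ CPre X₂)`. -/
theorem buchi_winning_region_eq_nested_fixpoint
    {N : Type} [Fintype N] (A : Arena N) (f : Set N) :
    {v | WinsFrom A (fun π => ∀ M : ℕ, ∃ i ≥ M, π i ∈ f) v} =
      kgfp (fun X1 => klfp (fun X2 => (f ∩ CPre A X1) ∪ (fᶜ ∩ CPre A X2))) := by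
  change {v | ∃ σ, BuchiWinning A f σ v} = _
  apply Set.Subset.antisymm
  · exact Set.subset_sUnion_of_mem fun v ⟨σ, hσ⟩ => Set.mem_sInter.2 fun Y hY =>
      hσ.mem_of_prefixpoint hY
  · refine Set.sUnion_subset fun X hX v hv => ?_
    obtain ⟨L, r, hXL, hL⟩ := exists_rank_of_postfixpoint hX
    exact exists_buchiWinning_of_rank r hL (hXL hv)
end

section
/- Let (V, V∃, V∀, E) be a game arena, γ : V → 2^C a coloring with colors C = {f₁,…,f_k}, and consider the generalized Büchi objective given by the Emerson-Lei formula ⋀_{1≤i≤k} Inf f_i. Then the winning region W∃ of the existential player equals the nested fixpoint νX₀.⋂_{1≤i≤k} μX_i.(({v | f_i ∈ γ(v)} ∩ CPre(X₀)) ∪ ({v | f_i ∉ γ(v), γ(v) ⊆ C∖{f_i}} ∩ CPre(X_i))), i.e., the solution of the equation system X₀ =_{GFP} ⋂_i X_i, X_i =_{LFP} ({v | f_i ∈ γ(v)} ∩ CPre(X₀)) ∪ ({v | f_i ∉ γ(v)} ∩ CPre(X_i)). -/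
/-- The generalized Büchi condition `⋀_{1 ≤ i ≤ k} Inf fᵢ` over colors `f₁,…,f_k`
(represented by `Fin k`). -/
def genBuchiFormula (k : ℕ) : ELFormula (Fin k) :=
  bigAnd ((List.finRange k).map .inf)

theorem elSat_genBuchiFormula {k : ℕ} {D : Set (Fin k)} :
    ELSat D (genBuchiFormula k) ↔ ∀ i, i ∈ D := by
  have h : ∀ l : List (Fin k), ELSat D (bigAnd (l.map .inf)) ↔ ∀ i ∈ l, i ∈ D := by
    intro l
    induction l with
    | nil => simp [bigAnd, ELSat]
    | cons a l ih => simp [bigAnd, ELSat, ih]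
  simp [genBuchiFormula, h]

theorem CPre_mono_s10 {N : Type} (A : Arena N) : Monotone (CPre A) := by
  rintro X Y h v (⟨hv, w, hw, hX⟩ | ⟨hv, hX⟩)
  · exact .inl ⟨hv, w, hw, h hX⟩
  · exact .inr ⟨hv, hX.trans h⟩

theorem map_klfp_subset {α : Type} {f : Set α → Set α} (hf : Monotone f) :
    f (klfp f) ⊆ klfp f :=
  Set.subset_sInter fun _ hX => (hf (Set.sInter_subset_of_mem hX)).trans hX

/-- On a finite type, membership in a least fixpoint is witnessed by a decreasing rank. -/
theorem exists_rank_klfp {α : Type} [Finite α] {f : Set α → Set α} (hf : Monotone f) :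
    ∃ r : α → ℕ, ∀ v ∈ klfp f, v ∈ f {w | w ∈ klfp f ∧ r w < r v} := by
  have hmono : Monotone fun n => f^[n] ∅ :=
    hf.monotone_iterate_of_le_map (Set.empty_subset _)
  obtain ⟨n, hn⟩ := WellFoundedGT.monotone_chain_condition ⟨_, hmono⟩
  have hsub : klfp f ⊆ f^[n] ∅ := by
    refine Set.sInter_subset_of_mem ?_
    have h := hn (n + 1) n.le_succ
    simp only [OrderHom.coe_mk, Function.iterate_succ_apply'] at h
    exact h.ge
  have hle : ∀ m, f^[m] ∅ ⊆ klfp f := by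
    intro m
    induction m with
    | zero => exact Set.empty_subset _
    | succ m ih =>
      rw [Function.iterate_succ_apply']
      exact (hf ih).trans (map_klfp_subset hf)
  refine ⟨fun v => sInf {m | v ∈ f^[m] ∅}, fun v hv => ?_⟩
  have hmem : v ∈ f^[sInf {m | v ∈ f^[m] ∅}] ∅ :=
    Nat.sInf_mem (s := {m | v ∈ f^[m] ∅}) ⟨n, hsub hv⟩
  cases hr : sInf {m | v ∈ f^[m] ∅} with
  | zero => simp [hr] at hmem
  | succ m =>
    rw [hr, Function.iterate_succ_apply'] at hmem
    have hsub' : f^[m] ∅ ⊆ {w | w ∈ klfp f ∧ sInf {j | w ∈ f^[j] ∅} < m + 1} :=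
      fun w hw => ⟨hle m hw, Nat.lt_succ_of_le (Nat.sInf_le hw)⟩
    simpa only [hr] using hf hsub' hmem

/-- The strategy `σ` wins `v` for the objective `α`. -/
def WinsWith {N : Type} (A : Arena N) (α : (ℕ → N) → Prop) (σ : List N → N → N) (v : N) :
    Prop :=
  (∀ h u, u ∈ A.Vex → σ h u ∈ A.E u) ∧
    ∀ π : ℕ → N, A.IsPlay π → π 0 = v →
      (∀ i, π i ∈ A.Vex → π (i + 1) = σ ((List.range i).map π) (π i)) → α π

theorem map_range_succ_eq_cons {N : Type} (π : ℕ → N) (n : ℕ) :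
    (List.range (n + 1)).map π = π 0 :: (List.range n).map fun m => π (m + 1) := by
  simp [List.range_succ_eq_map, Function.comp_def]

/-- A strategy winning for a prefix-independent objective leaves a winning residual strategy
after each compliant move. -/
theorem WinsWith.residual {N : Type} {A : Arena N} {α : (ℕ → N) → Prop}
    (hα : ∀ π, α π → α fun n => π (n + 1)) {σ : List N → N → N} {v w : N}
    (hσ : WinsWith A α σ v) (hw : w ∈ A.E v) (hvw : v ∈ A.Vex → w = σ [] v) :
    WinsWith A α (fun h => σ (v :: h)) w := by
  refine ⟨fun h => hσ.1 _, fun π hπ h0 hc => ?_⟩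
  refine hα (fun n => Nat.casesOn n v π) (hσ.2 (fun n => Nat.casesOn n v π) ?_ rfl ?_)
  · rintro (_ | n)
    · simpa [h0] using hw
    · exact hπ n
  · rintro (_ | n) hn
    · simpa [h0] using hvw hn
    · rw [map_range_succ_eq_cons]
      exact hc n hn

theorem setOf_winsFrom_subset_CPre {N : Type} {A : Arena N} {α : (ℕ → N) → Prop}
    (hα : ∀ π, α π → α fun n => π (n + 1)) :
    {v | WinsFrom A α v} ⊆ CPre A {v | WinsFrom A α v} := by
  rintro v ⟨σ, hσ⟩
  by_cases hv : v ∈ A.Vex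
  · exact .inl ⟨hv, σ [] v, hσ.1 [] v hv, _,
      WinsWith.residual hα hσ (hσ.1 [] v hv) fun _ => rfl⟩
  · exact .inr ⟨hv, fun w hw => ⟨_, WinsWith.residual hα hσ hw fun h => absurd h hv⟩⟩

/-- Compliant plays of a winning strategy stay in the winning region. -/
theorem WinsWith.winsFrom_apply {N : Type} {A : Arena N} {α : (ℕ → N) → Prop}
    (hα : ∀ π, α π → α fun n => π (n + 1)) (n : ℕ) {σ : List N → N → N} {π : ℕ → N}
    (hσ : WinsWith A α σ (π 0)) (hπ : A.IsPlay π)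
    (hc : ∀ i < n, π i ∈ A.Vex → π (i + 1) = σ ((List.range i).map π) (π i)) :
    WinsFrom A α (π n) := by
  induction n generalizing σ π with
  | zero => exact ⟨σ, hσ⟩
  | succ n ih =>
    refine ih (π := fun m => π (m + 1))
      (hσ.residual hα (hπ 0) (hc 0 n.succ_pos)) (fun m => hπ (m + 1)) fun i hi hv => ?_
    rw [← map_range_succ_eq_cons]
    exact hc (i + 1) (by omega) hv

/-- The play determined by a function choosing the next node from the history. -/
theorem exists_play_of_choice {N : Type} (next : List N → N → N) (v : N) :
    ∃ π : ℕ → N, π 0 = v ∧ ∀ n, π (n + 1) = next ((List.range n).map π) (π n) := by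
  let ρ : ℕ → List N × N := fun n => Nat.rec ([], v) (fun _ p => (p.1 ++ [p.2], next p.1 p.2)) n
  have hρ : ∀ n, (ρ n).1 = (List.range n).map fun m => (ρ m).2 := by
    intro n
    induction n with
    | zero => rfl
    | succ n ih =>
      rw [List.range_succ, List.map_append, ← ih]
      rfl
  refine ⟨fun n => (ρ n).2, rfl, fun n => ?_⟩
  rw [← hρ]

/-- The one-step function whose least fixpoint is the set of nodes from which a node of `B`
that controls a move to `X` can be forced. -/
def buchiStep {N : Type} (A : Arena N) (B X : Set N) (Y : Set N) : Set N :=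
  (B ∩ CPre A X) ∪ (Bᶜ ∩ CPre A Y)

theorem buchiStep_mono {N : Type} (A : Arena N) (B X : Set N) : Monotone (buchiStep A B X) :=
  fun _ _ h => Set.union_subset_union_right _ (Set.inter_subset_inter_right _ (CPre_mono_s10 A h))

theorem setOf_winsFrom_subset_klfp {N : Type} {A : Arena N} {α : (ℕ → N) → Prop}
    (hα : ∀ π, α π → α fun n => π (n + 1)) {B : Set N}
    (hB : ∀ π, α π → ∃ n, π n ∈ B) :
    {v | WinsFrom A α v} ⊆ klfp (buchiStep A B {v | WinsFrom A α v}) := by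
  classical
  set L := klfp (buchiStep A B {v | WinsFrom A α v})
  rintro v ⟨σ, hσ⟩
  by_contra hv
  have hnext : ∀ u, ∃ w ∈ A.E u, (∃ w ∈ A.E u, w ∉ L) → w ∉ L := by
    intro u
    by_cases h : ∃ w ∈ A.E u, w ∉ L
    · obtain ⟨w, hw, hwL⟩ := h
      exact ⟨w, hw, fun _ => hwL⟩
    · obtain ⟨w, hw⟩ := A.E_nonempty u
      exact ⟨w, hw, fun h' => absurd h' h⟩
  choose τ hτE hτL using hnext
  obtain ⟨π, h0, hstep⟩ :=
    exists_play_of_choice (fun h u => if u ∈ A.Vex then σ h u else τ u) v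
  have hplay : A.IsPlay π := by
    intro n
    rw [hstep]
    split_ifs with h
    exacts [hσ.1 _ _ h, hτE _]
  have hc : ∀ i, π i ∈ A.Vex → π (i + 1) = σ ((List.range i).map π) (π i) := by
    intro i hi
    rw [hstep, if_pos hi]
  have hfix : buchiStep A B {v | WinsFrom A α v} L ⊆ L := map_klfp_subset (buchiStep_mono ..)
  have hnB : ∀ n, π n ∉ L → π n ∉ B := fun n hn hb =>
    hn (hfix (.inl ⟨hb, setOf_winsFrom_subset_CPre hα
      (WinsWith.winsFrom_apply hα n (h0.symm ▸ hσ) hplay fun i _ => hc i)⟩))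
  have hnL : ∀ n, π n ∉ L := by
    intro n
    induction n with
    | zero => rwa [h0]
    | succ n ih =>
      have hpre : π n ∉ CPre A L := fun h => ih (hfix (.inr ⟨hnB n ih, h⟩))
      by_cases h : π n ∈ A.Vex
      · exact fun h' => hpre (.inl ⟨h, _, hplay n, h'⟩)
      · rw [hstep, if_neg h]
        refine hτL _ ?_
        by_contra! h'
        exact hpre (.inr ⟨h, h'⟩)
  obtain ⟨n, hn⟩ := hB π (hσ.2 π hplay h0 hc)
  exact hnB n (hnL n) hn

/-- If `X` is contained in all the least fixpoints for the target sets `B i`, then from `X` the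
existential player can visit every `B i` infinitely often, pursuing the targets in the order
given by a sequence `col` in which every index recurs. -/
theorem winsFrom_of_subset_klfp {N ι : Type} [Finite N] (A : Arena N) (B : ι → Set N)
    (col : ℕ → ι) (hcol : ∀ i M, ∃ t ≥ M, col t = i) {X : Set N}
    (hX : ∀ i, X ⊆ klfp (buchiStep A (B i) X)) {v : N} (hv : v ∈ X) :
    WinsFrom A (fun π => ∀ i, ∀ M : ℕ, ∃ n ≥ M, π n ∈ B i) v := by
  classical
  choose r hr using fun i => exists_rank_klfp (buchiStep_mono A (B i) X)
  set L := fun i => klfp (buchiStep A (B i) X)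
  let T : ι → N → Set N := fun i u => if u ∈ B i then X else {w | w ∈ L i ∧ r i w < r i u}
  have hT : ∀ i, ∀ u ∈ L i, u ∈ CPre A (T i u) := by
    intro i u hu
    rcases hr i u hu with h | h
    · simpa [T, h.1] using h.2
    · have hn : u ∉ B i := h.1
      simpa [T, hn] using h.2
  have hchoice : ∀ i u, ∃ w ∈ A.E u, (A.E u ∩ T i u).Nonempty → w ∈ T i u := by
    intro i u
    by_cases h : (A.E u ∩ T i u).Nonempty
    · obtain ⟨w, hw, hwT⟩ := h
      exact ⟨w, hw, fun _ => hwT⟩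
    · obtain ⟨w, hw⟩ := A.E_nonempty u
      exact ⟨w, hw, fun h' => absurd h' h⟩
  choose τ hτE hτT using hchoice
  let upd : ℕ → N → ℕ := fun t u => if u ∈ B (col t) then t + 1 else t
  refine ⟨fun h u => τ (col (h.foldl upd 0)) u, fun h u _ => hτE _ u, fun π hπ h0 hc => ?_⟩
  let c : ℕ → ℕ := fun n => ((List.range n).map π).foldl upd 0
  have hcs : ∀ n, c (n + 1) = upd (c n) (π n) := by
    intro n
    simp [c, List.range_succ]
  have hmem : ∀ n, π n ∈ L (col (c n)) → π (n + 1) ∈ T (col (c n)) (π n) := by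
    intro n hn
    rcases hT _ _ hn with ⟨hex, hne⟩ | ⟨hun, hsub⟩
    · rw [hc n hex]
      exact hτT _ _ hne
    · exact hsub (hπ n)
  have hinv : ∀ n, π n ∈ L (col (c n)) := by
    intro n
    induction n with
    | zero => exact hX _ (h0 ▸ hv)
    | succ n ih =>
      have h := hmem n ih
      rw [hcs]
      by_cases hb : π n ∈ B (col (c n))
      · simp only [T, if_pos hb] at h
        exact hX _ h
      · simp only [T, if_neg hb] at h
        simpa only [upd, if_neg hb] using h.1
  have hreach : ∀ d n, r (col (c n)) (π n) = d →
      ∃ m ≥ n, c m = c n ∧ π m ∈ B (col (c n)) := by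
    intro d
    induction d using Nat.strong_induction_on with
    | _ d ih =>
      intro n hd
      by_cases hb : π n ∈ B (col (c n))
      · exact ⟨n, le_rfl, rfl, hb⟩
      · have h := hmem n (hinv n)
        have hcn : c (n + 1) = c n := by rw [hcs]; simp only [upd, if_neg hb]
        simp only [T, if_neg hb] at h
        obtain ⟨m, hm, hcm, hmB⟩ := ih _ (hd ▸ h.2) (n + 1) (by rw [hcn])
        exact ⟨m, by omega, hcm.trans hcn, hcn ▸ hmB⟩
  have hall : ∀ n d, ∃ m ≥ n, c m = c n + d ∧ π m ∈ B (col (c n + d)) := by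
    intro n d
    induction d with
    | zero => exact hreach _ n rfl
    | succ d ih =>
      obtain ⟨m, hm, hcm, hmB⟩ := ih
      rw [← hcm] at hmB
      have hcm' : c (m + 1) = c n + (d + 1) := by
        rw [hcs]
        simp only [upd, if_pos hmB]
        omega
      obtain ⟨m', hm', h⟩ := hreach _ (m + 1) rfl
      rw [hcm'] at h
      exact ⟨m', by omega, h⟩
  intro i M
  obtain ⟨t, ht, rfl⟩ := hcol i (c M)
  obtain ⟨m, hm, -, hmB⟩ := hall M (t - c M)
  rw [Nat.add_sub_cancel' ht] at hmB
  exact ⟨m, hm, hmB⟩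

/-- For the generalized Büchi objective given by the Emerson-Lei formula
`⋀_{1 ≤ i ≤ k} Inf fᵢ` and a coloring `γ`, the winning region of the existential player
is the nested fixpoint
`νX₀.⋂_i μXᵢ.(({v | fᵢ ∈ γ v} ∩ CPre X₀) ∪ ({v | fᵢ ∉ γ v} ∩ CPre Xᵢ))`, i.e. the
solution of the equation system `X₀ =_GFP ⋂_i Xᵢ`,
`Xᵢ =_LFP ({v | fᵢ ∈ γ v} ∩ CPre X₀) ∪ ({v | fᵢ ∉ γ v} ∩ CPre Xᵢ)`. -/
theorem genBuchi_winning_region_eq_nested_fixpoint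
    {N : Type} [Fintype N] (A : Arena N) (k : ℕ) (γ : N → Set (Fin k)) :
    {v | WinsFrom A
        (fun π => ELSat {c : Fin k | ∀ M : ℕ, ∃ n ≥ M, c ∈ γ (π n)} (genBuchiFormula k)) v} =
      kgfp (fun X0 => ⋂ i : Fin k, klfp (fun Xi =>
        ({v | i ∈ γ v} ∩ CPre A X0) ∪ ({v | i ∉ γ v} ∩ CPre A Xi))) := by
  simp only [elSat_genBuchiFormula, Set.mem_ofPred_eq]
  apply subset_antisymm
  · refine Set.subset_sUnion_of_mem (Set.subset_iInter fun i => ?_)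
    refine setOf_winsFrom_subset_klfp (B := {v | i ∈ γ v}) ?_ ?_
    · intro π h j M
      obtain ⟨n, hn, hj⟩ := h j (M + 1)
      exact ⟨n - 1, by omega, by simpa [Nat.sub_add_cancel (show 1 ≤ n by omega)] using hj⟩
    · intro π h
      obtain ⟨n, -, hn⟩ := h i 0
      exact ⟨n, hn⟩
  · rintro v ⟨X, hX, hv⟩
    rcases k.eq_zero_or_pos with rfl | hk
    · choose s hs using A.E_nonempty
      exact ⟨fun _ => s, fun _ u _ => hs u, fun _ _ _ _ i => i.elim0⟩
    · refine winsFrom_of_subset_klfp A (fun i => {v | i ∈ γ v})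
        (fun t => ⟨t % k, Nat.mod_lt t hk⟩) (fun i M => ⟨i + k * M, ?_, ?_⟩)
        (fun i => hX.trans (Set.iInter_subset _ i)) hv
      · nlinarith
      · ext
        simp [Nat.mod_eq_of_lt i.isLt]
end
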